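/- arXiv:2202.09563 — 3 statements merged into one kernel-verified Lean document; each statement's English description precedes it below -/
import Mathlib

section
/- Let G be a finite insoluble group and x ∈ G such that Sol_G(x) is a subgroup of G. Then |Sol_G(x)| is not a power p^n of any odd prime p. -/
def Sol {G : Type*} [Group G] (x : G) : Set G :=
  {y | IsSolvable ↥(Subgroup.closure {x, y})}

universe u

theorem aux_pow_ge {p n : ℕ} (hp : 3 ≤ p) (hn : 1 ≤ n) : n ≤ p ^ (n - 1) := by
  obtain ⟨m, rfl⟩ : ∃ m, n = m + 1 := ⟨n - 1, by omega⟩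
  simp only [Nat.add_sub_cancel]
  exact Nat.lt_pow_self (by omega)

theorem aux_pow_gt {p n : ℕ} (hp : 3 ≤ p) (hn : 2 ≤ n) : n < p ^ (n - 1) := by
  obtain ⟨m, rfl⟩ : ∃ m, n = m + 2 := ⟨n - 2, by omega⟩
  have h1 : m < p ^ m := Nat.lt_pow_self (by omega)
  have : m + 2 - 1 = m + 1 := by omega
  rw [this, pow_succ]
  nlinarith

theorem comb_aux {A Λ : Type*} [Group A] [Finite A] [Nontrivial A] [Finite Λ] [MulAction A Λ]
    (hA : ∀ a b : A, a * b = b * a) (hf : ∀ a : A, (∀ χ : Λ, a • χ = χ) → a = 1)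
    {p : ℕ} (hp : 3 ≤ p) :
    ∃ N : Set Λ, (∀ χ : Λ, ∃ a : A, a • χ ∉ N) ∧ Nat.card A < p ^ (Nat.card N) := by
  classical
  have := Fintype.ofFinite Λ
  let Ω := MulAction.orbitRel.Quotient A Λ
  let mk : Λ → Ω := Quotient.mk''
  have : Fintype Ω := Fintype.ofFinite _
  have hmk (χ ψ : Λ) : mk χ = mk ψ ↔ ∃ a : A, a • ψ = χ := by
    show Quotient.mk'' _ = Quotient.mk'' _ ↔ _
    rw [Quotient.eq'']
    rfl
  have hout (ω : Ω) : mk ω.out = ω := Quotient.out_eq' ω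
  let F : Ω → Finset Λ := fun ω => Finset.univ.filter (fun χ => mk χ = ω)
  have hFmem (ω : Ω) : ω.out ∈ F ω := by simp [F, hout]
  have hFpos (ω : Ω) : 1 ≤ (F ω).card := Finset.card_pos.mpr ⟨_, hFmem ω⟩
  refine ⟨{χ | χ ≠ (mk χ).out}, fun χ => ?_, ?_⟩
  · obtain ⟨a, ha⟩ := (hmk (mk χ).out χ).1 (hout _)
    refine ⟨a, ?_⟩
    have : mk (a • χ) = mk χ := (hmk _ _).2 ⟨a, rfl⟩
    show ¬ (a • χ ≠ (mk (a • χ)).out)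
    rw [this, ha]; simp
  · have hN : Nat.card {χ : Λ | χ ≠ (mk χ).out} = ∑ ω : Ω, ((F ω).card - 1) := by
      rw [Nat.card_eq_fintype_card, ← Set.toFinset_card,
        Finset.card_eq_sum_card_fiberwise (f := mk) (t := Finset.univ) (by simp)]
      refine Finset.sum_congr rfl fun ω _ => ?_
      rw [← Finset.card_erase_of_mem (hFmem ω)]
      congr 1
      ext χ
      simp only [Set.toFinset_ofPred, Finset.mem_filter, Finset.mem_univ, true_and,
        Finset.mem_erase, F]
      constructor
      · rintro ⟨h1, rfl⟩; exact ⟨h1, rfl⟩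
      · rintro ⟨h1, rfl⟩; exact ⟨h1, rfl⟩
    rw [hN, ← Finset.prod_pow_eq_pow_sum]
    have h1 : Nat.card A ≤ ∏ ω : Ω, (F ω).card := by
      have : Fintype A := Fintype.ofFinite _
      rw [← Fintype.card_piFinset, Nat.card_eq_fintype_card, ← Finset.card_univ]
      refine Finset.card_le_card_of_injOn (fun a ω => a • ω.out) ?_ ?_
      · intro a _
        simp only [Finset.mem_coe, Fintype.mem_piFinset, F, Finset.mem_filter, Finset.mem_univ,
          true_and]
        intro ω
        exact ((hmk _ _).2 ⟨a, rfl⟩).trans (hout ω)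
      · intro a _ b _ hab
        have h : b⁻¹ * a = 1 := by
          refine hf _ fun χ => ?_
          obtain ⟨c, hc⟩ := (hmk χ (mk χ).out).1 (hout _).symm
          have := congrFun hab (mk χ)
          simp only at this
          rw [← hc, ← mul_smul, hA, mul_smul, mul_smul, this, inv_smul_smul]
        exact (inv_mul_eq_one.1 h).symm
    refine lt_of_le_of_lt h1 ?_
    obtain ⟨a, ha⟩ := exists_ne (1 : A)
    have : ∃ χ : Λ, a • χ ≠ χ := by
      by_contra! h
      exact ha (hf a h)
    obtain ⟨χ, hχ⟩ := this
    refine Finset.prod_lt_prod (fun ω _ => hFpos ω) (fun ω _ => aux_pow_ge hp (hFpos ω))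
      ⟨mk χ, Finset.mem_univ _, aux_pow_gt hp ?_⟩
    refine Finset.one_lt_card.2 ⟨a • χ, ?_, χ, ?_, hχ⟩
    · simp only [F, Finset.mem_filter, Finset.mem_univ, true_and]
      exact (hmk _ _).2 ⟨a, rfl⟩
    · simp [F]

open Module in
theorem weight_aux {k V A K : Type*} [Field k] [IsAlgClosed k] [AddCommGroup V] [Module k V]
    [FiniteDimensional k V] [Group A] [Finite A] [Nontrivial A] [Group K] [Finite K]
    (hA : ∀ a b : A, a * b = b * a) (hK : ∀ a b : K, a * b = b * a)
    (hcard : (Nat.card K : k) ≠ 0)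
    (ρ : A →* End k V) (τ : K →* End k V) (σ : A →* MulAut K)
    (hσ : ∀ a g, ρ a * τ g = τ (σ a g) * ρ a)
    (hf : ∀ a, (∀ g, Commute (ρ a) (τ g)) → a = 1)
    {p : ℕ} (hp : 3 ≤ p) (I : Submodule k V) (hI : ∀ v ∈ I, ∀ a, ρ a v = v) :
    Nat.card A * p ^ finrank k I < p ^ finrank k V := by
  classical
  have hss (g : K) : (τ g).IsSemisimple := by
    refine Module.End.isSemisimple_of_squarefree_aeval_eq_zero
      (p := (Polynomial.X ^ Nat.card K - Polynomial.C 1 : Polynomial k)) ?_ ?_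
    · exact (Polynomial.separable_X_pow_sub_C (1 : k) hcard one_ne_zero).squarefree
    · rw [map_sub, map_pow, Polynomial.aeval_X, ← map_pow, pow_card_eq_one']; simp
  let W : (K → k) → Submodule k V := fun χ => ⨅ g, (τ g).maxGenEigenspace (χ g)
  have hW (χ : K → k) (v : V) : v ∈ W χ ↔ ∀ g, τ g v = χ g • v := by
    simp only [W, Submodule.mem_iInf]
    refine forall_congr' fun g => ?_
    rw [(hss g).isFinitelySemisimple.maxGenEigenspace_eq_eigenspace, End.mem_eigenspace_iff]
  have hcomm (g h : K) : Commute (τ g) (τ h) := by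
    show _ * _ = _ * _
    rw [← map_mul, hK, map_mul]
  have hind : iSupIndep W := End.independent_iInf_maxGenEigenspace_of_forall_mapsTo _
    (fun i j φ => End.mapsTo_maxGenEigenspace_of_comm (hcomm _ _) φ)
  have htop : ⨆ χ, W χ = ⊤ := End.iSup_iInf_maxGenEigenspace_eq_top_of_forall_mapsTo _
    (fun i j φ => End.mapsTo_maxGenEigenspace_of_comm (hcomm _ _) φ)
    (fun i => End.iSup_maxGenEigenspace_eq_top _)
  let act : A → (K → k) → (K → k) := fun a χ g => χ (σ a⁻¹ g)
  have hmap (a : A) (χ : K → k) (v : V) (hv : v ∈ W χ) : ρ a v ∈ W (act a χ) := by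
    rw [hW] at hv ⊢
    intro g
    have h1 := hσ a (σ a⁻¹ g)
    have h2 : σ a (σ a⁻¹ g) = g := by
      rw [← MulAut.mul_apply, ← map_mul]; simp
    rw [h2] at h1
    have h3 := congrArg (fun f => f v) h1
    simp only [End.mul_apply] at h3
    rw [← h3, hv, map_smul]
  have hρinj (a : A) (v : V) (h : ρ a v = 0) : v = 0 := by
    have : ρ a⁻¹ (ρ a v) = v := by rw [← End.mul_apply, ← map_mul]; simp
    rw [← this, h, map_zero]
  let Λ := {χ : K → k // W χ ≠ ⊥}
  have : Finite Λ := (WellFoundedGT.finite_ne_bot_of_iSupIndep hind)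
  have hne (a : A) (χ : Λ) : W (act a χ) ≠ ⊥ := by
    obtain ⟨v, hv, hv0⟩ := Submodule.exists_mem_ne_zero_of_ne_bot χ.2
    exact Submodule.ne_bot_iff _ |>.2 ⟨ρ a v, hmap _ _ _ hv, fun h => hv0 (hρinj a v h)⟩
  let _ : MulAction A Λ :=
    { smul := fun a χ => ⟨act a χ, hne a χ⟩
      one_smul := fun χ => Subtype.ext (by funext g; show χ.1 (σ (1:A)⁻¹ g) = _; simp)
      mul_smul := fun a b χ => Subtype.ext (by
        funext g
        show χ.1 (σ (a * b)⁻¹ g) = χ.1 (σ b⁻¹ (σ a⁻¹ g))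
        rw [mul_inv_rev, map_mul, MulAut.mul_apply]) }
  have hsm (a : A) (χ : Λ) : ((a • χ : Λ) : K → k) = act a χ := rfl
  have hind' : iSupIndep (fun χ : Λ => W χ) := hind.comp Subtype.val_injective
  have hfaith (a : A) (h : ∀ χ : Λ, a • χ = χ) : a = 1 := by
    refine hf a fun g => ?_
    show _ = _
    ext v
    have : v ∈ ⨆ χ, W χ := by rw [htop]; trivial
    induction this using Submodule.iSup_induction' with
    | mem χ v hv =>
      by_cases hv0 : v = 0
      · simp [hv0]
      have hχ : W χ ≠ ⊥ := (Submodule.ne_bot_iff _).2 ⟨v, hv, hv0⟩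
      have h1 := hmap a χ v hv
      have h2 : act a χ = χ := congrArg Subtype.val (h ⟨χ, hχ⟩)
      rw [h2] at h1
      rw [hW] at h1 hv
      simp [hv, h1]
    | zero => simp
    | add x y _ _ hx hy => rw [map_add, map_add, hx, hy]
  obtain ⟨N, hN1, hN2⟩ := comb_aux (Λ := Λ) hA hfaith hp
  have hex (χ : Λ) : ∃ v ∈ W χ, v ≠ 0 := Submodule.exists_mem_ne_zero_of_ne_bot χ.2
  choose e heW he0 using hex
  have hli : LinearIndependent k e := hind'.linearIndependent (fun χ : Λ => W χ) heW he0
  let e' : N → V := fun χ => e χ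
  have hli' : LinearIndependent k e' := hli.comp _ Subtype.val_injective
  have := Fintype.ofFinite Λ
  have hdis : Disjoint I (Submodule.span k (Set.range e')) := by
    rw [Submodule.disjoint_def]
    intro v hvI hv
    have h1 : ∃ w : Λ → V, (∀ χ : Λ, w χ ∈ W χ) ∧ (∀ χ, χ ∉ N → w χ = 0) ∧ v = ∑ χ : Λ, w χ := by
      clear hvI
      induction hv using Submodule.span_induction with
      | mem x hx =>
        obtain ⟨χ, rfl⟩ := hx
        refine ⟨Pi.single χ.1 (e χ.1), fun ψ => ?_, fun ψ hψ => ?_, ?_⟩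
        · by_cases h : ψ = χ.1
          · subst h; simpa using heW _
          · simp [h]
        · have : ψ ≠ χ.1 := by rintro rfl; exact hψ χ.2
          simp [this]
        · simp [e']
      | zero => exact ⟨0, by simp, by simp, by simp⟩
      | add x y _ _ hx hy =>
        obtain ⟨w, h1, h2, rfl⟩ := hx
        obtain ⟨w', h1', h2', rfl⟩ := hy
        exact ⟨w + w', fun χ => add_mem (h1 χ) (h1' χ), fun χ h => by simp [h2 χ h, h2' χ h],
          by simp [Finset.sum_add_distrib]⟩
      | smul c x _ hx =>
        obtain ⟨w, h1, h2, rfl⟩ := hx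
        exact ⟨c • w, fun χ => Submodule.smul_mem _ _ (h1 χ), fun χ h => by simp [h2 χ h],
          by simp [Finset.smul_sum]⟩
    obtain ⟨w, hw1, hw2, rfl⟩ := h1
    have key (a : A) (χ : Λ) : ρ a (w (a⁻¹ • χ)) = w χ := by
      have h2 : ∑ χ : Λ, (ρ a (w (a⁻¹ • χ)) - w χ) = 0 := by
        rw [Finset.sum_sub_distrib, sub_eq_zero]
        rw [← (hI _ hvI a), map_sum]
        exact Fintype.sum_equiv (MulAction.toPerm a⁻¹) _ _ (fun χ => rfl)
      have h3 : ∀ χ : Λ, ρ a (w (a⁻¹ • χ)) - w χ ∈ W χ := by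
        intro χ
        refine sub_mem ?_ (hw1 χ)
        have := hmap a _ _ (hw1 (a⁻¹ • χ))
        rwa [← hsm, smul_inv_smul] at this
      have h5 := ((iSupIndep_iff_finsetSum_eq_zero_imp_eq_zero _).1 hind') Finset.univ
        _ (fun χ _ => h3 χ) h2 χ (Finset.mem_univ _)
      exact sub_eq_zero.1 h5
    refine Finset.sum_eq_zero fun χ _ => ?_
    obtain ⟨a, ha⟩ := hN1 χ
    rw [← key a⁻¹ χ, inv_inv, hw2 _ ha, map_zero]
  have hfin := Submodule.finrank_add_finrank_le_of_disjoint hdis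
  have : Fintype N := Fintype.ofFinite _
  rw [finrank_span_eq_card hli', ← Nat.card_eq_fintype_card] at hfin
  calc Nat.card A * p ^ finrank k I < p ^ (Nat.card N) * p ^ finrank k I := by
        exact Nat.mul_lt_mul_of_pos_right hN2 (by positivity)
    _ = p ^ (finrank k I + Nat.card N) := by rw [← pow_add, add_comm]
    _ ≤ _ := Nat.pow_le_pow_right (by omega) hfin

open Module TensorProduct in
theorem weight_zmod {p : ℕ} [Fact p.Prime] (hp : 3 ≤ p) {V A K : Type*} [AddCommGroup V]
    [Module (ZMod p) V] [Finite V] [Group A] [Finite A] [Nontrivial A] [Group K] [Finite K]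
    (hA : ∀ a b : A, a * b = b * a) (hK : ∀ a b : K, a * b = b * a)
    (hcard : ¬ p ∣ Nat.card K)
    (ρ : A →* End (ZMod p) V) (τ : K →* End (ZMod p) V) (σ : A →* MulAut K)
    (hσ : ∀ a g, ρ a * τ g = τ (σ a g) * ρ a)
    (hf : ∀ a, (∀ g, Commute (ρ a) (τ g)) → a = 1)
    (I : Submodule (ZMod p) V) (hI : ∀ v ∈ I, ∀ a, ρ a v = v) :
    Nat.card A * Nat.card I < Nat.card V := by
  let k := AlgebraicClosure (ZMod p)
  have : Module.Finite (ZMod p) V := Module.Finite.of_finite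
  have : CharP k p := inferInstance
  let b : End (ZMod p) V →* End k (k ⊗[ZMod p] V) :=
    { toFun := fun f => f.baseChange k
      map_one' := LinearMap.baseChange_one _ _
      map_mul' := fun f g => LinearMap.baseChange_mul f g }
  have hb : Function.Injective b := by
    intro f g hfg
    ext v
    have h1 := congrArg (fun F => F (1 ⊗ₜ[ZMod p] v)) hfg
    have h2 : (1 : k) ⊗ₜ[ZMod p] (f v) = 1 ⊗ₜ[ZMod p] (g v) := by simpa [b] using h1
    exact Module.FaithfullyFlat.tensorProduct_mk_injective (A := ZMod p) (B := k) V h2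
  have h := weight_aux (k := k) (V := k ⊗[ZMod p] V) hA hK
    (by rwa [Ne, CharP.cast_eq_zero_iff k p]) (b.comp ρ) (b.comp τ) σ
    (fun a g => by
      have := congrArg b (hσ a g)
      simpa using this)
    (fun a ha => hf a fun g => hb (by
      have := (ha g).eq
      simpa using this)) hp (I.baseChange k) (by
      intro v hv a
      rw [Submodule.baseChange_eq_span] at hv
      induction hv using Submodule.span_induction with
      | mem x hx =>
        obtain ⟨y, hy, rfl⟩ := hx
        simp [b, hI y hy a]
      | zero => simp
      | add x y _ _ hx hy => rw [map_add, hx, hy]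
      | smul c x _ hx => rw [map_smul, hx])
  have hfr : finrank k (I.baseChange k) = finrank (ZMod p) I := by
    rw [← (Submodule.toBaseChange.toLinearEquiv (A := k) I).finrank_eq, Module.finrank_baseChange]
  rw [hfr, Module.finrank_baseChange] at h
  have e1 := Module.natCard_eq_pow_finrank (K := ZMod p) (V := V)
  have e2 := Module.natCard_eq_pow_finrank (K := ZMod p) (V := I)
  rw [Nat.card_zmod] at e1 e2
  rwa [e1, e2]


def IsPC (p : ℕ) {G : Type*} [Group G] (N : Subgroup G) : Prop :=
  N.Normal ∧ (Nat.card N).Coprime p ∧ ∃ k, N.index = p ^ k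

def PNil (p : ℕ) (G : Type*) [Group G] : Prop := ∃ N : Subgroup G, IsPC p N

section PartB

variable {p : ℕ} [hp : Fact p.Prime]

lemma IsPC.mem_iff {G : Type*} [Group G] [Finite G] {N : Subgroup G} (h : IsPC p N) (g : G) :
    g ∈ N ↔ (orderOf g).Coprime p := by
  obtain ⟨h1, h2, k, h3⟩ := h
  constructor
  · intro hg
    exact Nat.Coprime.coprime_dvd_left (Subgroup.orderOf_dvd_natCard N hg) h2
  · intro hg
    have h4 : orderOf (QuotientGroup.mk' N g) ∣ orderOf g := orderOf_map_dvd _ g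
    have h5 : orderOf (QuotientGroup.mk' N g) ∣ p ^ k := by
      rw [← h3]; exact orderOf_dvd_natCard _
    have h6 := Nat.Coprime.pow_right k hg
    have h7 := Nat.eq_one_of_dvd_coprimes h6 h4 h5
    rw [orderOf_eq_one_iff] at h7
    exact (QuotientGroup.eq_one_iff g).1 h7

lemma PNil.of_injective {G H : Type*} [Group G] [Group H] [Finite G] (h : PNil p G)
    (f : H →* G) (hf : Function.Injective f) : PNil p H := by
  obtain ⟨N, h1, h2, k, h3⟩ := h
  refine ⟨N.comap f, inferInstance, ?_, ?_⟩
  · exact Nat.Coprime.coprime_dvd_left (Subgroup.card_comap_dvd_of_injective N f hf) h2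
  · have : (N.comap f).index ∣ p ^ k := by
      rw [Subgroup.index_comap, ← h3]
      exact Subgroup.relIndex_dvd_index_of_normal N f.range
    obtain ⟨j, _, hj⟩ := (Nat.dvd_prime_pow hp.out).1 this
    exact ⟨j, hj⟩

lemma PNil.of_surjective {G H : Type*} [Group G] [Group H] [Finite G] (h : PNil p G)
    (f : G →* H) (hf : Function.Surjective f) : PNil p H := by
  obtain ⟨N, h1, h2, k, h3⟩ := h
  refine ⟨N.map f, h1.map f hf, ?_, ?_⟩
  · exact Nat.Coprime.coprime_dvd_left (Subgroup.card_map_dvd N f) h2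
  · have : (N.map f).index ∣ p ^ k := by
      rw [← h3]
      exact Subgroup.index_map_dvd N hf
    obtain ⟨j, _, hj⟩ := (Nat.dvd_prime_pow hp.out).1 this
    exact ⟨j, hj⟩

lemma PNil.mono {G : Type*} [Group G] [Finite G] {H K : Subgroup G} (h : PNil p K) (hle : H ≤ K) :
    PNil p H :=
  h.of_injective (Subgroup.inclusion hle) (Subgroup.inclusion_injective hle)

lemma PNil.subgroup {G : Type*} [Group G] [Finite G] (h : PNil p G) (H : Subgroup G) :
    PNil p H :=
  h.of_injective H.subtype H.subtype_injective

lemma PNil.of_top {G : Type*} [Group G] [Finite G] (h : PNil p (⊤ : Subgroup G)) : PNil p G :=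
  h.of_surjective (⊤ : Subgroup G).subtype (fun x => ⟨⟨x, trivial⟩, rfl⟩)

lemma PNil.of_isPGroup {G : Type*} [Group G] [Finite G] (h : IsPGroup p G) : PNil p G := by
  obtain ⟨n, hn⟩ := IsPGroup.iff_card.1 h
  exact ⟨⊥, inferInstance, by simp, n, by simpa using hn⟩

/-- relative version: complement of a subgroup `H`, as a subgroup of `G`. -/
lemma PNil.exists_rel {G : Type*} [Group G] [Finite G] {H : Subgroup G} (h : PNil p H) :
    ∃ M : Subgroup G, M ≤ H ∧ (∀ g, g ∈ M ↔ g ∈ H ∧ (orderOf g).Coprime p) ∧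
      (Nat.card M).Coprime p ∧ (∃ k, M.relIndex H = p ^ k) ∧
      (∀ g ∈ Subgroup.normalizer (H : Set G), ∀ m ∈ M, g * m * g⁻¹ ∈ M) := by
  obtain ⟨N, hN⟩ := h
  have key : ∀ g, g ∈ N.map H.subtype ↔ g ∈ H ∧ (orderOf g).Coprime p := by
    intro g
    constructor
    · rintro ⟨n, hn, rfl⟩
      refine ⟨n.2, ?_⟩
      have := (hN.mem_iff n).1 hn
      simpa using this
    · rintro ⟨h1, h2⟩
      refine ⟨⟨g, h1⟩, (hN.mem_iff _).2 ?_, rfl⟩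
      simpa using h2
  refine ⟨N.map H.subtype, ?_, key, ?_, ?_, ?_⟩
  · exact Subgroup.map_subtype_le N
  · exact Nat.Coprime.coprime_dvd_left (Subgroup.card_map_dvd N H.subtype) hN.2.1
  · obtain ⟨k, hk⟩ := hN.2.2
    refine ⟨k, ?_⟩
    rw [← hk]
    have := Subgroup.relIndex_map_map_of_injective (f := H.subtype) N ⊤ H.subtype_injective
    rw [← MonoidHom.range_eq_map, Subgroup.range_subtype] at this
    rw [this, Subgroup.relIndex_top_right]
  · intro g hg m hm
    rw [key] at hm ⊢
    refine ⟨(Subgroup.mem_normalizer_iff.1 hg m).1 hm.1, ?_⟩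
    have : orderOf (g * m * g⁻¹) = orderOf m := by
      have := orderOf_injective (MulAut.conj g).toMonoidHom (MulAut.conj g).injective m
      simpa using this
    rw [this]; exact hm.2

lemma PNil.exists_normal {G : Type*} [Group G] [Finite G] {H : Subgroup G} [hH : H.Normal]
    (h : PNil p H) : ∃ M : Subgroup G, M.Normal ∧ M ≤ H ∧ (Nat.card M).Coprime p ∧
      ∃ k, M.relIndex H = p ^ k := by
  obtain ⟨M, h1, -, h3, h4, h5⟩ := h.exists_rel
  refine ⟨M, ⟨fun m hm g => h5 g ?_ m hm⟩, h1, h3, h4⟩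
  rw [Subgroup.normalizer_eq_top]; trivial

lemma PNil.of_normal {G : Type*} [Group G] [Finite G] {H : Subgroup G} [hH : H.Normal]
    (h : PNil p H) (hi : ∃ k, H.index = p ^ k) : PNil p G := by
  obtain ⟨M, h1, h2, h3, k, hk⟩ := h.exists_normal
  obtain ⟨j, hj⟩ := hi
  refine ⟨M, h1, h3, k + j, ?_⟩
  rw [← Subgroup.relIndex_mul_index h2, hk, hj, pow_add]

lemma card_comap_mk' {G : Type*} [Group G] [Finite G] (L : Subgroup G) [L.Normal]
    (N : Subgroup (G ⧸ L)) :
    Nat.card (N.comap (QuotientGroup.mk' L)) = Nat.card L * Nat.card N := by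
  have h1 := Subgroup.card_mul_index (N.comap (QuotientGroup.mk' L))
  rw [Subgroup.index_comap_of_surjective _ (QuotientGroup.mk'_surjective L)] at h1
  have h2 := Subgroup.card_mul_index L
  have h3 := Subgroup.card_mul_index N
  rw [Subgroup.index_eq_card L, ← h3, ← h1, ← mul_assoc] at h2
  exact (Nat.eq_of_mul_eq_mul_right (Nat.pos_of_ne_zero Subgroup.index_ne_zero_of_finite) h2).symm

/-- quotient by a normal group of order prime to p. -/
lemma PNil.of_quotient {G : Type*} [Group G] [Finite G] (L : Subgroup G) [L.Normal]
    (hL : (Nat.card L).Coprime p) (h : PNil p (G ⧸ L)) : PNil p G := by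
  obtain ⟨N, h1, h2, k, h3⟩ := h
  refine ⟨N.comap (QuotientGroup.mk' L), inferInstance, ?_, k, ?_⟩
  · rw [card_comap_mk']
    exact Nat.Coprime.mul_left hL h2
  · rw [Subgroup.index_comap_of_surjective _ (QuotientGroup.mk'_surjective L), h3]

lemma comm_of_coprime {G : Type*} [Group G] [Finite G] {M U X : Subgroup G}
    (hM : (Nat.card M).Coprime p) (hU : IsPGroup p U)
    (hMX : M ≤ X) (hUX : U ≤ X)
    (h1 : X ≤ Subgroup.normalizer (M : Set G)) (h2 : X ≤ Subgroup.normalizer (U : Set G)) :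
    ∀ m ∈ M, ∀ u ∈ U, m * u = u * m := by
  intro m hm u hu
  have hd : ∀ z, z ∈ M → z ∈ U → z = 1 := by
    intro z hz1 hz2
    obtain ⟨n, hn⟩ := IsPGroup.iff_orderOf.1 hU ⟨z, hz2⟩
    have h3 : orderOf z ∣ p ^ n := by rw [← hn]; simp
    have h4 := Subgroup.orderOf_dvd_natCard M hz1
    have := Nat.eq_one_of_dvd_coprimes (Nat.Coprime.pow_right n hM) h4 h3
    exact orderOf_eq_one_iff.1 this
  have hz : m * u * m⁻¹ * u⁻¹ = 1 := by
    apply hd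
    · have : u * m⁻¹ * u⁻¹ ∈ M := (Subgroup.mem_normalizer_iff.1 (h1 (hUX hu)) m⁻¹).1 (M.inv_mem hm)
      have := M.mul_mem hm this
      simpa [mul_assoc] using this
    · have : m * u * m⁻¹ ∈ U := (Subgroup.mem_normalizer_iff.1 (h2 (hMX hm)) u).1 hu
      exact U.mul_mem this (U.inv_mem hu)
  have := mul_inv_eq_one.1 hz
  rw [mul_inv_eq_iff_eq_mul] at this
  exact this

lemma PNil.of_central_sylow {G : Type*} [Group G] [Finite G] (P : Sylow p G)
    (h : ∀ g ∈ (P : Subgroup G), ∀ y : G, y * g = g * y) : PNil p G := by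
  have hP : Subgroup.normalizer (P : Set G) ≤ Subgroup.centralizer (P : Set G) := by
    intro y _
    rw [Subgroup.mem_centralizer_iff]
    intro g hg
    exact (h g hg y).symm
  refine ⟨(MonoidHom.transferSylow P hP).ker, inferInstance, ?_, ?_⟩
  · have := MonoidHom.not_dvd_card_ker_transferSylow P hP
    exact ((Nat.Prime.coprime_iff_not_dvd hp.out).2 this).symm
  · have := MonoidHom.ker_transferSylow_isComplement' P hP
    obtain ⟨n, hn⟩ := IsPGroup.iff_card.1 P.2
    exact ⟨n, by rw [this.symm.index_eq_card, ← hn]⟩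

/-- N, M complement; two Sylow subgroups are conjugate by an element of the complement. -/
lemma IsPC.sylow_conj {G : Type*} [Group G] [Finite G] {N : Subgroup G} (hN : IsPC p N)
    (S T : Sylow p G) : ∃ m ∈ N, m • S = T := by
  obtain ⟨h1, h2, k, hk⟩ := hN
  have hsup : N ⊔ (S : Subgroup G) = ⊤ := by
    rw [← Subgroup.index_eq_one]
    have a1 : (N ⊔ (S : Subgroup G)).index ∣ p ^ k := by
      rw [← hk]; exact Subgroup.index_dvd_of_le le_sup_left
    have a2 : (N ⊔ (S : Subgroup G)).index ∣ (S : Subgroup G).index :=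
      Subgroup.index_dvd_of_le le_sup_right
    have a3 := S.not_dvd_index
    exact Nat.eq_one_of_dvd_coprimes (Nat.Coprime.pow_right k ((Nat.Prime.coprime_iff_not_dvd hp.out).2 a3).symm) a2 a1
  obtain ⟨g, hg⟩ := MulAction.exists_smul_eq G S T
  have hgt : g ∈ N ⊔ (S : Subgroup G) := by rw [hsup]; trivial
  obtain ⟨m, hm, s, hs, rfl⟩ := Subgroup.mem_sup_of_normal_left.1 hgt
  refine ⟨m, hm, ?_⟩
  rw [← hg, mul_smul]
  congr 1
  symm
  rw [Sylow.smul_eq_iff_mem_normalizer]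
  exact Subgroup.le_normalizer hs

lemma PNil.of_normalizer_map {G H : Type*} [Group G] [Group H] [Finite G] (f : H →* G)
    (hf : Function.Injective f) (U : Subgroup H)
    (h : PNil p (Subgroup.normalizer (U.map f : Set G))) :
    PNil p (Subgroup.normalizer (U : Set H)) := by
  have hle := Subgroup.le_normalizer_map (H := U) f
  refine h.of_injective ((f.comp (Subgroup.subtype _)).codRestrict _ ?_) ?_
  · rintro ⟨x, hx⟩
    exact hle ⟨x, hx, rfl⟩
  · intro a b hab
    have : f a = f b := congrArg Subtype.val hab
    exact Subtype.ext (hf this)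

end PartB


section PartC

variable {p : ℕ} [hp : Fact p.Prime]

lemma exists_mem_normalizer {G : Type*} [Group G] [Finite G] {P D : Subgroup G}
    (hP : IsPGroup p P) (hD : D ≤ P) (hne : D ≠ P) :
    ∃ u ∈ P, u ∉ D ∧ u ∈ Subgroup.normalizer (D : Set G) := by
  have := hP.isNilpotent
  have hlt : D.subgroupOf P < ⊤ := by
    rw [lt_top_iff_ne_top]
    intro h
    rw [Subgroup.subgroupOf_eq_top] at h
    exact hne (le_antisymm hD h)
  have := normalizerCondition_of_isNilpotent (G := P) _ hlt
  obtain ⟨u, hu1, hu2⟩ := SetLike.exists_of_lt this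
  refine ⟨u, u.2, fun h => hu2 (Subgroup.mem_subgroupOf.2 h), ?_⟩
  rw [Subgroup.mem_normalizer_iff] at hu1 ⊢
  intro h
  constructor
  · intro hh
    have := (hu1 ⟨h, hD hh⟩).1 (Subgroup.mem_subgroupOf.2 hh)
    exact Subgroup.mem_subgroupOf.1 this
  · intro hh
    have hhP : h ∈ P := by
      have := P.mul_mem (P.mul_mem (P.inv_mem u.2) (hD hh)) u.2
      simpa [mul_assoc] using this
    have := (hu1 ⟨h, hhP⟩).2 (Subgroup.mem_subgroupOf.2 hh)
    exact Subgroup.mem_subgroupOf.1 this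

lemma IsPC.sup_sylow {G : Type*} [Group G] [Finite G] {N : Subgroup G} (hN : IsPC p N)
    (S : Sylow p G) : N ⊔ (S : Subgroup G) = ⊤ := by
  obtain ⟨h1, h2, k, hk⟩ := hN
  rw [← Subgroup.index_eq_one]
  have a1 : (N ⊔ (S : Subgroup G)).index ∣ p ^ k := by
    rw [← hk]; exact Subgroup.index_dvd_of_le le_sup_left
  have a2 : (N ⊔ (S : Subgroup G)).index ∣ (S : Subgroup G).index :=
    Subgroup.index_dvd_of_le le_sup_right
  have a3 := S.not_dvd_index
  exact Nat.eq_one_of_dvd_coprimes (Nat.Coprime.pow_right k ((Nat.Prime.coprime_iff_not_dvd hp.out).2 a3).symm) a2 a1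

/-- A complement of the normalizer of a p-subgroup centralizes the p-subgroup. -/
lemma IsPC.comm {G : Type*} [Group G] [Finite G] {D : Subgroup G} (hD : IsPGroup p D)
    {N : Subgroup (Subgroup.normalizer (D : Set G))} (hN : IsPC p N) (m) (hm : m ∈ N) :
    ∀ d ∈ D, (m : G) * d = d * m := by
  intro d hd
  have := hN.1
  have hDN : D ≤ Subgroup.normalizer (D : Set G) := Subgroup.le_normalizer
  have h1 : IsPGroup p (D.subgroupOf (Subgroup.normalizer (D : Set G))) :=
    hD.comap_of_injective _ (Subgroup.subtype_injective _)
  have := comm_of_coprime (p := p) (X := ⊤) hN.2.1 h1 le_top le_top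
    (Subgroup.normalizer_eq_top_iff.2 inferInstance |>.ge)
    (Subgroup.normalizer_eq_top_iff.2 inferInstance |>.ge) m hm ⟨d, hDN hd⟩
    (Subgroup.mem_subgroupOf.2 hd)
  exact congrArg Subtype.val this

open Pointwise in
lemma frob_conj {G : Type*} [Group G] [Finite G]
    (hG : ∀ U : Subgroup G, IsPGroup p U → U ≠ ⊥ → PNil p (Subgroup.normalizer (U : Set G))) :
    ∀ n : ℕ, ∀ P Q : Sylow p G, Nat.card G - Nat.card ((P : Subgroup G) ⊓ Q : Subgroup G) = n →
    ∃ c : G, (∀ d ∈ P, d ∈ Q → c * d = d * c) ∧ c • P = Q := by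
  intro n
  induction n using Nat.strong_induction_on with
  | _ n ih =>
  intro P Q hn
  set D : Subgroup G := (P : Subgroup G) ⊓ Q with hDdef
  by_cases hD0 : D = ⊥
  · obtain ⟨g, hg⟩ := MulAction.exists_smul_eq G P Q
    refine ⟨g, ?_, hg⟩
    intro d hd1 hd2
    have : d ∈ D := ⟨hd1, hd2⟩
    rw [hD0, Subgroup.mem_bot] at this
    simp [this]
  by_cases hDP : D = P
  · have hle : (P : Subgroup G) ≤ Q := by rw [← hDP]; exact inf_le_right
    have : (Q : Subgroup G) = P := P.3 Q.2 hle
    refine ⟨1, by simp, ?_⟩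
    rw [one_smul]; exact Sylow.ext this.symm
  have hDQ : D ≠ Q := by
    intro h
    have hle : (Q : Subgroup G) ≤ P := by rw [← h]; exact inf_le_left
    have : (P : Subgroup G) = Q := Q.3 P.2 hle
    apply hDP
    rw [h, this]
  have hDp : IsPGroup p D := P.2.to_le inf_le_left
  obtain ⟨N0, hN0⟩ := hG D hDp hD0
  set N := Subgroup.normalizer (D : Set G) with hN
  obtain ⟨S, hS⟩ := IsPGroup.exists_le_sylow
    (P.2.comap_of_injective N.subtype N.subtype_injective)
  obtain ⟨T, hT⟩ := IsPGroup.exists_le_sylow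
    (Q.2.comap_of_injective N.subtype N.subtype_injective)
  obtain ⟨m, hm, hmST⟩ := hN0.sylow_conj S T
  obtain ⟨R, hR⟩ := IsPGroup.exists_le_sylow (S.2.map N.subtype)
  have hDN : D ≤ N := Subgroup.le_normalizer
  have hmD := IsPC.comm hDp hN0 m hm
  -- elements
  obtain ⟨u, huP, huD, huN⟩ := exists_mem_normalizer P.2 (D := D) inf_le_left hDP
  obtain ⟨v, hvQ, hvD, hvN⟩ := exists_mem_normalizer Q.2 (D := D) inf_le_right hDQ
  have hPR : ∀ a, a ∈ P → a ∈ N → a ∈ R := by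
    intro a ha1 ha2
    exact hR ⟨⟨a, ha2⟩, hS ha1, rfl⟩
  have hQR : ∀ a, a ∈ Q → a ∈ N → a ∈ ((m : G) • R : Sylow p G) := by
    intro a ha1 ha2
    have h1 : (⟨a, ha2⟩ : N) ∈ T := hT ha1
    rw [← hmST] at h1
    change (⟨a, ha2⟩ : N) ∈ ((m • S : Sylow p N) : Subgroup N) at h1
    rw [Sylow.coe_subgroup_smul, Subgroup.mem_pointwise_smul_iff_inv_smul_mem] at h1
    change a ∈ (((m : G) • R : Sylow p G) : Subgroup G)
    rw [Sylow.coe_subgroup_smul, Subgroup.mem_pointwise_smul_iff_inv_smul_mem]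
    have := hR ⟨_, h1, rfl⟩
    simpa using this
  have hcard : ∀ X : Subgroup G, D ≤ X → (∃ a ∈ X, a ∉ D) →
      Nat.card G - Nat.card X < n := by
    rintro X hX ⟨a, ha1, ha2⟩
    have hlt : D < X := lt_of_le_of_ne hX (fun h => ha2 (h ▸ ha1))
    have h1 : Nat.card D < Nat.card X := by
      apply Set.ncard_lt_ncard (s := (D : Set G)) (t := (X : Set G)) hlt
    have h2 : Nat.card X ≤ Nat.card G := Subgroup.card_le_card_group X
    omega
  obtain ⟨c1, hc1, hc1'⟩ := ih _ (hcard ((P : Subgroup G) ⊓ R)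
    (fun d hd => ⟨hd.1, hPR d hd.1 (hDN hd)⟩) ⟨u, ⟨huP, hPR u huP huN⟩, huD⟩) P R rfl
  obtain ⟨c2, hc2, hc2'⟩ := ih _ (hcard ((((m : G) • R : Sylow p G) : Subgroup G) ⊓ Q)
    (fun d hd => ⟨hQR d hd.2 (hDN hd), hd.2⟩) ⟨v, ⟨hQR v hvQ hvN, hvQ⟩, hvD⟩) ((m : G) • R) Q rfl
  refine ⟨c2 * (m * c1), ?_, ?_⟩
  · intro d hdP hdQ
    have hd : d ∈ D := ⟨hdP, hdQ⟩
    have e1 := hc1 d hdP (hPR d hdP (hDN hd))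
    have e2 := hmD d hd
    have e3 := hc2 d (hQR d hdQ (hDN hd)) hdQ
    calc c2 * (m * c1) * d = c2 * m * (c1 * d) := by group
      _ = c2 * (m * d) * c1 := by rw [e1]; group
      _ = (c2 * d) * m * c1 := by rw [e2]; group
      _ = d * (c2 * (m * c1)) := by rw [e3]; group
  · rw [mul_smul, mul_smul, hc1', hc2']

open Pointwise in
open scoped commutatorElement in
theorem frobenius_aux : ∀ n : ℕ, ∀ (G : Type u) [Group G] [Finite G], Nat.card G = n →
    (∀ U : Subgroup G, IsPGroup p U → U ≠ ⊥ → PNil p (Subgroup.normalizer (U : Set G))) →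
    PNil p G := by
  intro n
  induction n using Nat.strong_induction_on with
  | _ n ih =>
  intro G _ _ hcard hG
  obtain ⟨P⟩ : Nonempty (Sylow p G) := inferInstance
  by_cases hP0 : (P : Subgroup G) = ⊥
  · apply PNil.of_central_sylow P
    intro g hg y
    rw [hP0, Subgroup.mem_bot] at hg
    simp [hg]
  have hfoc : (P : Subgroup G).focalSubgroup ≤ ⁅(P : Subgroup G), (P : Subgroup G)⁆ := by
    rw [Subgroup.focalSubgroup, Subgroup.closure_le]
    rintro g ⟨hgP, x, hx, u, rfl⟩
    rw [commutatorElement_def] at hgP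
    have hy : u * x⁻¹ * u⁻¹ ∈ P := by
      have := (P : Subgroup G).mul_mem ((P : Subgroup G).inv_mem hx) hgP
      have h2 : x⁻¹ * (x * u * x⁻¹ * u⁻¹) = u * x⁻¹ * u⁻¹ := by group
      rw [h2] at this; exact this
    obtain ⟨c, hc, hcP⟩ := frob_conj hG _ P (u • P) rfl
    have hy2 : u * x⁻¹ * u⁻¹ ∈ (u • P : Sylow p G) := by
      change _ ∈ ((u • P : Sylow p G) : Subgroup G)
      rw [Sylow.coe_subgroup_smul, Subgroup.mem_pointwise_smul_iff_inv_smul_mem]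
      have := (P : Subgroup G).inv_mem hx
      simpa [mul_assoc] using this
    have e1 := hc _ hy hy2
    have hn : c⁻¹ * u ∈ Subgroup.normalizer (P : Set G) := by
      rw [← Sylow.smul_eq_iff_mem_normalizer, mul_smul, ← hcP, inv_smul_smul]
    obtain ⟨M, hM⟩ := hG P P.2 hP0
    have hM' := hM
    have := hM.1
    have hsup := hM.sup_sylow (P.subtype Subgroup.le_normalizer)
    have hmem : (⟨c⁻¹ * u, hn⟩ : Subgroup.normalizer (P : Set G)) ∈
        M ⊔ (P.subtype Subgroup.le_normalizer : Subgroup (Subgroup.normalizer (P : Set G))) := by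
      rw [hsup]; trivial
    obtain ⟨m, hm, s, hs, hms⟩ := Subgroup.mem_sup_of_normal_left.1 hmem
    have hs' : (s : G) ∈ P := hs
    have e2 : (m : G) * s = c⁻¹ * u := congrArg Subtype.val hms
    have hsx : (s : G) * x⁻¹ * (s : G)⁻¹ ∈ (P : Subgroup G) :=
      Subgroup.mul_mem _ (Subgroup.mul_mem _ hs' (Subgroup.inv_mem _ hx)) (Subgroup.inv_mem _ hs')
    have e3 := IsPC.comm P.2 hM m hm _ hsx
    have hu : u = c * (m * s) := by rw [e2]; group
    have e4 : u * x⁻¹ * u⁻¹ = s * x⁻¹ * (s : G)⁻¹ := by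
      have a1 : u * x⁻¹ * u⁻¹ = c⁻¹ * (u * x⁻¹ * u⁻¹) * c := by
        rw [mul_assoc c⁻¹, ← e1]; group
      rw [a1]
      have a2 : c⁻¹ * (u * x⁻¹ * u⁻¹) * c = m * (s * x⁻¹ * (s : G)⁻¹) * (m : G)⁻¹ := by
        rw [hu]; group
      rw [a2, e3]; group
    have e5 : ⁅x, u⁆ = ⁅x, (s : G)⁆ := by
      rw [commutatorElement_def, commutatorElement_def]
      have : x * u * x⁻¹ * u⁻¹ = x * (u * x⁻¹ * u⁻¹) := by group
      rw [this, e4]; group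
    rw [e5]
    exact Subgroup.commutator_mem_commutator hx hs'
  have hlt : ¬ (P : Subgroup G) ≤ ⁅(P : Subgroup G), (P : Subgroup G)⁆ := by
    have : Group.IsNilpotent P := P.2.isNilpotent
    have : Nontrivial (P : Subgroup G) := (Subgroup.nontrivial_iff_ne_bot _).2 hP0
    have h1 := IsSolvable.commutator_lt_top_of_nontrivial (P : Subgroup G)
    intro hle
    apply h1.ne
    rw [eq_top_iff]
    intro z _
    have hz := hle z.2
    rw [← Subgroup.map_subtype_commutator] at hz
    obtain ⟨w, hw, hwz⟩ := hz
    have : w = z := Subtype.ext hwz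
    rw [← this]; exact hw
  set M := (P : Subgroup G).transferFocal.ker with hM
  have hMinf : M ⊓ P = (P : Subgroup G).focalSubgroup := Subgroup.ker_transferFocal_inf_eq_focalSubgroup P
  have hMtop : M ≠ ⊤ := by
    intro h
    rw [h, top_inf_eq] at hMinf
    exact hlt (hMinf.le.trans hfoc)
  have hidx : ∃ k, M.index = p ^ k := by
    have h1 : M.index = Nat.card (P ⧸ (P : Subgroup G).focalSubgroupOf) := by
      rw [hM, Subgroup.index_ker, MonoidHom.range_eq_top.2 (Subgroup.transferFocal_surjective P),
        Subgroup.card_top]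
    rw [h1]
    exact IsPGroup.iff_card.1 (P.2.to_quotient _)
  have hMlt : Nat.card M < n := by
    rw [← hcard]
    refine lt_of_le_of_ne (Subgroup.card_le_card_group M) ?_
    intro h
    exact hMtop (Subgroup.eq_top_of_card_eq M h)
  have hMnil : PNil p M := by
    refine ih _ hMlt M rfl ?_
    intro U hU hU0
    apply PNil.of_normalizer_map M.subtype M.subtype_injective
    apply hG _ (hU.map _)
    rwa [Ne, Subgroup.map_eq_bot_iff_of_injective _ M.subtype_injective]
  exact hMnil.of_normal hidx

theorem frobenius_crit {G : Type*} [Group G] [Finite G]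
    (h : ∀ U : Subgroup G, IsPGroup p U → U ≠ ⊥ → PNil p (Subgroup.normalizer (U : Set G))) :
    PNil p G := frobenius_aux _ G rfl h

end PartC


section PartD

variable {p : ℕ} [hp : Fact p.Prime]

def Hyp (p : ℕ) {G : Type*} [Group G] (P : Sylow p G) : Prop :=
  ∀ C : Subgroup (P : Subgroup G), C.Characteristic → C ≠ ⊥ →
    PNil p (Subgroup.normalizer (C.map (P : Subgroup G).subtype : Set G))

lemma char_map {A B : Type*} [Group A] [Group B] (e : A ≃* B) (C : Subgroup A)
    (hC : C.Characteristic) : (C.map e.toMonoidHom).Characteristic := by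
  rw [Subgroup.characteristic_iff_map_le] at hC ⊢
  intro φ
  rintro _ ⟨_, ⟨c, hc, rfl⟩, rfl⟩
  have := hC ((e.trans φ).trans e.symm) ⟨c, hc, rfl⟩
  refine ⟨_, this, ?_⟩
  simp

lemma exists_equiv {G G' : Type*} [Group G] [Group G'] (f : G →* G') (P : Subgroup G)
    (P' : Subgroup G') (hP : P.map f = P') (hinj : ∀ a ∈ P, f a = 1 → a = 1) :
    ∃ e : P ≃* P', ∀ a : P, (e a : G') = f a := by
  subst hP
  refine ⟨MulEquiv.ofBijective (f.subgroupMap P) ⟨?_, f.subgroupMap_surjective P⟩, fun a => rfl⟩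
  rw [injective_iff_map_eq_one]
  intro a ha
  have : f a = 1 := congrArg Subtype.val ha
  exact Subtype.ext (hinj a a.2 this)

lemma map_transport {G G' : Type*} [Group G] [Group G'] (f : G →* G') (P : Subgroup G)
    (P' : Subgroup G') (e : P ≃* P') (he : ∀ a : P, (e a : G') = f a) (C : Subgroup P) :
    (C.map e.toMonoidHom).map P'.subtype = (C.map P.subtype).map f := by
  rw [Subgroup.map_map, Subgroup.map_map]
  congr 1
  ext a
  exact he a

/-- every characteristic subgroup of the image comes from one below -/
lemma char_pull {G G' : Type*} [Group G] [Group G'] (f : G →* G') (P : Subgroup G)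
    (P' : Subgroup G') (hP : P.map f = P') (hinj : ∀ a ∈ P, f a = 1 → a = 1)
    (C' : Subgroup P') (hC' : C'.Characteristic) (hne : C' ≠ ⊥) :
    ∃ C : Subgroup P, C.Characteristic ∧ C ≠ ⊥ ∧
      (C.map P.subtype).map f = C'.map P'.subtype := by
  obtain ⟨e, he⟩ := exists_equiv f P P' hP hinj
  have h1 : (C'.map e.symm.toMonoidHom).map e.toMonoidHom = C' := by
    rw [Subgroup.map_map]
    convert Subgroup.map_id C'
    ext a
    simp
  refine ⟨C'.map e.symm.toMonoidHom, char_map _ _ hC', ?_, ?_⟩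
  · intro h
    rw [h, Subgroup.map_bot] at h1
    exact hne h1.symm
  · rw [← map_transport f P P' e he, h1]

lemma char_push {G G' : Type*} [Group G] [Group G'] (f : G →* G') (P : Subgroup G)
    (P' : Subgroup G') (hP : P.map f = P') (hinj : ∀ a ∈ P, f a = 1 → a = 1)
    (C : Subgroup P) (hC : C.Characteristic) (hne : C ≠ ⊥) :
    ∃ C' : Subgroup P', C'.Characteristic ∧ C' ≠ ⊥ ∧
      C'.map P'.subtype = (C.map P.subtype).map f := by
  obtain ⟨e, he⟩ := exists_equiv f P P' hP hinj
  refine ⟨C.map e.toMonoidHom, char_map _ _ hC, ?_, map_transport f P P' e he C⟩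
  rwa [Ne, Subgroup.map_eq_bot_iff_of_injective _ e.injective]

lemma Hyp.of_map {G : Type*} [Group G] [Finite G] {N : Subgroup G} (S : Sylow p N)
    (Q : Subgroup G) (hQ : (S : Subgroup N).map N.subtype = Q)
    (h : ∀ C : Subgroup Q, C.Characteristic → C ≠ ⊥ →
      PNil p (Subgroup.normalizer (C.map Q.subtype : Set G))) : Hyp p S := by
  intro C hC hne
  apply PNil.of_normalizer_map N.subtype N.subtype_injective
  obtain ⟨C', h1, h2, h3⟩ := char_push N.subtype S Q hQ
    (fun a _ ha => N.subtype_injective (by simpa using ha)) C hC hne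
  rw [← h3]
  exact h C' h1 h2

open Pointwise in
lemma Hyp.conj {G : Type*} [Group G] [Finite G] {P : Sylow p G} (h : Hyp p P) (Q : Sylow p G) :
    Hyp p Q := by
  obtain ⟨g, rfl⟩ := MulAction.exists_smul_eq G P Q
  intro C' hC' hne
  have hmap : (P : Subgroup G).map (MulAut.conj g).toMonoidHom = ((g • P : Sylow p G) : Subgroup G) := by
    rw [Sylow.coe_subgroup_smul]; rfl
  obtain ⟨C, h1, h2, h3⟩ := char_pull (MulAut.conj g).toMonoidHom P _ hmap
    (fun a _ ha => (MulAut.conj g).injective (by simpa using ha)) C' hC' hne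
  have h4 := h C h1 h2
  apply PNil.of_normalizer_map (MulAut.conj g).symm.toMonoidHom (MulAut.conj g).symm.injective
  rw [← h3, Subgroup.map_map]
  have h5 : (MulAut.conj g).symm.toMonoidHom.comp (MulAut.conj g).toMonoidHom = MonoidHom.id G := by
    ext a
    exact (MulAut.conj g).symm_apply_apply a
  rw [h5, Subgroup.map_id]
  exact h4

lemma normalizer_le_char {G : Type*} [Group G] (S : Subgroup G) (C : Subgroup S)
    (hC : C.Characteristic) :
    Subgroup.normalizer (S : Set G) ≤ Subgroup.normalizer (C.map S.subtype : Set G) := by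
  have key : ∀ u ∈ Subgroup.normalizer (S : Set G), ∀ c ∈ C.map S.subtype,
      u * c * u⁻¹ ∈ C.map S.subtype := by
    rintro u hu _ ⟨c, hc, rfl⟩
    rw [Subgroup.characteristic_iff_map_le] at hC
    have := hC (S.normalizerMonoidHom ⟨u, hu⟩) ⟨c, hc, rfl⟩
    exact ⟨_, this, rfl⟩
  intro u hu
  rw [Subgroup.mem_normalizer_iff]
  intro c
  constructor
  · exact key u hu c
  · intro h
    have := key u⁻¹ (Subgroup.inv_mem _ hu) _ h
    simpa [mul_assoc] using this

/-- for a subgroup of index prime to `p`, Sylow subgroups of it are Sylow subgroups. -/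
lemma exists_sylow_of_index {G : Type*} [Group G] [Finite G] (H : Subgroup G) (h : ¬ p ∣ H.index)
    (S : Sylow p H) : ∃ P : Sylow p G, (P : Subgroup G) = (S : Subgroup H).map H.subtype := by
  refine ⟨(S.2.map H.subtype).toSylow ?_, rfl⟩
  rw [Subgroup.index_map_subtype]
  exact fun hd => (hp.out.dvd_mul.1 hd).elim S.not_dvd_index h

lemma normalizer_quot {G : Type*} [Group G] [Finite G] (X L : Subgroup G) [hL : L.Normal]
    (hX : IsPGroup p X) (hc : (Nat.card L).Coprime p) :
    Subgroup.normalizer (X.map (QuotientGroup.mk' L) : Set (G ⧸ L)) ≤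
      (Subgroup.normalizer (X : Set G)).map (QuotientGroup.mk' L) := by
  intro gb hgb
  obtain ⟨g, rfl⟩ := QuotientGroup.mk'_surjective L gb
  set W := X ⊔ L with hW
  have hcomap : (X.map (QuotientGroup.mk' L)).comap (QuotientGroup.mk' L) = W := by
    rw [Subgroup.comap_map_eq, QuotientGroup.ker_mk']
  have hXW : X ≤ W := le_sup_left
  have hgX : ∀ x ∈ X, g * x * g⁻¹ ∈ W := by
    intro x hx
    rw [← hcomap, Subgroup.mem_comap, map_mul, map_mul, map_inv]
    exact (Subgroup.mem_normalizer_iff.1 hgb _).1 ⟨x, hx, rfl⟩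
  have hidx : ¬ p ∣ (X.subgroupOf W).index := by
    intro hd
    have h1 : X.relIndex W = Nat.card L := by
      obtain ⟨n, hn⟩ := IsPGroup.iff_card.1 hX
      have hco : (Nat.card L).Coprime (Nat.card X) := by rw [hn]; exact hc.pow_right n
      have a1 := Subgroup.relIndex_mul_relIndex ⊥ X W bot_le hXW
      have a2 := Subgroup.relIndex_mul_relIndex ⊥ L W bot_le le_sup_right
      rw [Subgroup.relIndex_bot_left, Subgroup.relIndex_bot_left] at a1 a2
      have a3 : L.relIndex W = Nat.card X := by
        rw [hW, Subgroup.relIndex_sup_right, ← Subgroup.inf_relIndex_right,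
          Subgroup.inf_eq_bot_of_coprime hco, Subgroup.relIndex_bot_left]
      rw [a3, mul_comm, ← a1] at a2
      exact (Nat.eq_of_mul_eq_mul_left Nat.card_pos a2).symm
    change p ∣ X.relIndex W at hd
    rw [h1] at hd
    exact (Nat.Prime.coprime_iff_not_dvd hp.out).1 hc.symm hd
  let S : Sylow p W := IsPGroup.toSylow (hX.comap_of_injective W.subtype W.subtype_injective) hidx
  have hSmem : ∀ w : W, w ∈ S ↔ (w : G) ∈ X := fun w => Iff.rfl
  let Y : Subgroup G := X.map (MulAut.conj g).toMonoidHom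
  have hY : IsPGroup p Y := hX.map _
  have hYW : Y ≤ W := by
    rintro _ ⟨x, hx, rfl⟩
    exact hgX x hx
  obtain ⟨T, hT⟩ := IsPGroup.exists_le_sylow (hY.comap_of_injective W.subtype W.subtype_injective)
  obtain ⟨w, hw⟩ := MulAction.exists_smul_eq W T S
  obtain ⟨x, hx, l, hl, hxl⟩ := Subgroup.mem_sup_of_normal_right.1 w.2
  have key : ∀ y ∈ X, (l * g) * y * (l * g)⁻¹ ∈ X := by
    intro y hy
    have h1 : (⟨g * y * g⁻¹, hgX y hy⟩ : W) ∈ T := hT (show g * y * g⁻¹ ∈ Y from ⟨y, hy, rfl⟩)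
    have h2 : w * (⟨g * y * g⁻¹, hgX y hy⟩ : W) * w⁻¹ ∈ S := by
      rw [← hw]
      exact ⟨_, h1, rfl⟩
    rw [hSmem] at h2
    have h3 : (w : G) * (g * y * g⁻¹) * (w : G)⁻¹ ∈ X := h2
    rw [← hxl] at h3
    have h4 := X.mul_mem (X.mul_mem (X.inv_mem hx) h3) hx
    convert h4 using 1
    group
  refine ⟨l * g, ?_, ?_⟩
  · have hle : X.map (MulAut.conj (l * g)).toMonoidHom ≤ X := by
      rintro _ ⟨y, hy, rfl⟩
      exact key y hy
    have heq : X.map (MulAut.conj (l * g)).toMonoidHom = X := by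
      apply Subgroup.eq_of_le_of_card_ge hle
      rw [Subgroup.card_map_of_injective (MulAut.conj (l * g)).injective]
    change l * g ∈ Subgroup.normalizer (X : Set G)
    rw [Subgroup.mem_normalizer_iff]
    intro h
    refine ⟨key h, fun hh => ?_⟩
    rw [← heq] at hh
    obtain ⟨y, hy, hyh⟩ := hh
    have : y = h := (MulAut.conj (l * g)).injective hyh
    rw [← this]; exact hy
  · rw [map_mul]
    have : (QuotientGroup.mk' L) l = 1 := (QuotientGroup.eq_one_iff l).2 hl
    rw [this, one_mul]

/-- image of a PNil subgroup -/
lemma PNil.map {G H : Type*} [Group G] [Group H] [Finite G] {N : Subgroup G} (h : PNil p N)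
    (f : G →* H) : PNil p (N.map f) :=
  h.of_surjective (f.subgroupMap N) (f.subgroupMap_surjective N)

lemma Hyp.quot {G : Type*} [Group G] [Finite G] {P : Sylow p G} (h : Hyp p P)
    (L : Subgroup G) [L.Normal] (hc : (Nat.card L).Coprime p) :
    Hyp p (P.mapSurjective (QuotientGroup.mk'_surjective L)) := by
  intro C' hC' hne
  have hinj : ∀ a ∈ (P : Subgroup G), QuotientGroup.mk' L a = 1 → a = 1 := by
    intro a ha h1
    have h2 : a ∈ L := (QuotientGroup.eq_one_iff a).1 h1
    obtain ⟨n, hn⟩ := IsPGroup.iff_orderOf.1 P.2 ⟨a, ha⟩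
    have h3 : orderOf a ∣ p ^ n := by rw [← hn]; simp
    have h4 := Subgroup.orderOf_dvd_natCard L h2
    have := Nat.eq_one_of_dvd_coprimes (Nat.Coprime.pow_right n hc) h4 h3
    exact orderOf_eq_one_iff.1 this
  obtain ⟨C, h1, h2, h3⟩ := char_pull (QuotientGroup.mk' L) P _ (by simp) hinj C' hC' hne
  rw [← h3]
  refine PNil.mono ((h C h1 h2).map (QuotientGroup.mk' L)) (normalizer_quot _ L ?_ hc)
  exact (P.2.to_subgroup C).map _

end PartD



section PartD

variable {p : ℕ} [hp : Fact p.Prime]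

lemma card_lt_of_ne_top {G : Type*} [Group G] [Finite G] {H : Subgroup G} (h : H ≠ ⊤) :
    Nat.card H < Nat.card G := by
  refine lt_of_le_of_ne (Subgroup.card_le_card_group H) ?_
  intro h1
  exact h (Subgroup.eq_top_of_card_eq H h1)

lemma card_quot_lt {G : Type*} [Group G] [Finite G] {L : Subgroup G} (h : L ≠ ⊥) :
    Nat.card (G ⧸ L) < Nat.card G := by
  have h1 := Subgroup.card_mul_index L
  have h2 : 1 < Nat.card L := by
    rw [Subgroup.one_lt_card_iff_ne_bot]; exact h
  rw [← h1]
  have h3 : 0 < L.index := Nat.pos_of_ne_zero Subgroup.index_ne_zero_of_finite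
  change L.index < _
  nlinarith

lemma card_lt_card_of_lt {G : Type*} [Group G] [Finite G] {D X : Subgroup G} (h : D < X) :
    Nat.card D < Nat.card X :=
  Set.ncard_lt_ncard (s := (D : Set G)) (t := (X : Set G)) h

/-- p-part is at least that of any p-subgroup -/
lemma le_fact {G : Type*} [Group G] [Finite G] {T N : Subgroup G} (h : T ≤ N) {b : ℕ}
    (hT : Nat.card T = p ^ b) : b ≤ (Nat.card N).factorization p := by
  have h1 : p ^ b ∣ Nat.card N := by rw [← hT]; exact Subgroup.card_dvd_of_le h
  exact (Nat.Prime.pow_dvd_iff_le_factorization hp.out Nat.card_pos.ne').1 h1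

def IHyp (p : ℕ) (n : ℕ) : Prop := ∀ (G : Type u) [Group G] [Finite G], Nat.card G < n →
  ∀ P : Sylow p G, Hyp p P → PNil p G

lemma exists_U {G : Type u} [Group G] [Finite G] (ih : IHyp.{u} p (Nat.card G))
    (P : Sylow p G) (hP : Hyp p P) (hnot : ¬ PNil p G) :
    ∃ U : Subgroup G, U.Normal ∧ IsPGroup p U ∧ U ≠ ⊥ ∧
      ∀ C : Subgroup G, IsPGroup p C → U < C → (P : Subgroup G) ≤ Subgroup.normalizer (C : Set G) →
        PNil p (Subgroup.normalizer (C : Set G)) := by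
  let s : Set (Subgroup G) := {U | IsPGroup p U ∧ U ≠ ⊥ ∧
    ¬ PNil p (Subgroup.normalizer (U : Set G))}
  have hs : s.Nonempty := by
    by_contra h
    rw [Set.not_nonempty_iff_eq_empty] at h
    apply hnot
    apply frobenius_crit
    intro U hU hU0
    by_contra h2
    have : U ∈ s := ⟨hU, hU0, h2⟩
    rw [h] at this
    exact this
  let a : Subgroup G → ℕ := fun U => (Nat.card (Subgroup.normalizer (U : Set G))).factorization p
  let μ : Subgroup G → ℕ := fun U => a U * (Nat.card G + 1) + Nat.card U
  obtain ⟨U, ⟨hU1, hU2, hU3⟩, hmax⟩ := Set.exists_max_image s μ (Set.toFinite s) hs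
  have m1 : ∀ C : Subgroup G, IsPGroup p C → C ≠ ⊥ → a U < a C →
      PNil p (Subgroup.normalizer (C : Set G)) := by
    intro C h1 h2 h3
    by_contra h4
    have h5 := hmax C ⟨h1, h2, h4⟩
    have h6 : Nat.card U ≤ Nat.card G := Subgroup.card_le_card_group U
    have h7 : (a U + 1) * (Nat.card G + 1) ≤ a C * (Nat.card G + 1) := Nat.mul_le_mul_right _ h3
    simp only [μ] at h5
    rw [add_mul] at h7
    omega
  have m2 : ∀ C : Subgroup G, IsPGroup p C → U < C → a U ≤ a C →
      PNil p (Subgroup.normalizer (C : Set G)) := by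
    intro C h1 h2 h3
    by_contra h4
    have h5 := hmax C ⟨h1, (bot_le.trans_lt h2).ne', h4⟩
    have h7 : (a U) * (Nat.card G + 1) ≤ a C * (Nat.card G + 1) := Nat.mul_le_mul_right _ h3
    have := card_lt_card_of_lt h2
    simp only [μ] at h5
    omega
  have htop : Subgroup.normalizer (U : Set G) = ⊤ := by
    by_contra hne
    apply hU3
    obtain ⟨S⟩ : Nonempty (Sylow p (Subgroup.normalizer (U : Set G))) := inferInstance
    refine ih _ (card_lt_of_ne_top hne) S (Hyp.of_map S _ rfl ?_)
    set S' := (S : Subgroup (Subgroup.normalizer (U : Set G))).map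
      (Subgroup.normalizer (U : Set G)).subtype with hS'
    intro C hC hC0
    have hS'p : IsPGroup p S' := S.2.map _
    obtain ⟨R, hR⟩ := IsPGroup.exists_le_sylow hS'p
    have hnc := normalizer_le_char S' C hC
    by_cases hSR : S' = R
    · have hRh := hP.conj R
      obtain ⟨C', h1, h2, h3⟩ := char_push (MonoidHom.id G) S' R (by rw [Subgroup.map_id, hSR])
        (by simp) C hC hC0
      rw [Subgroup.map_id] at h3
      rw [← h3]
      exact hRh C' h1 h2
    · obtain ⟨v, hv1, hv2, hv3⟩ := exists_mem_normalizer R.2 hR hSR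
      apply m1
      · exact (hS'p.to_subgroup C).map _
      · rwa [Ne, Subgroup.map_eq_bot_iff_of_injective _ S'.subtype_injective]
      · have hT : IsPGroup p ((R : Subgroup G) ⊓ Subgroup.normalizer (S' : Set G) : Subgroup G) :=
          R.2.to_le inf_le_left
        obtain ⟨b, hb⟩ := IsPGroup.iff_card.1 hT
        have h1 := le_fact (inf_le_right.trans hnc) hb
        have hlt : S' < (R : Subgroup G) ⊓ Subgroup.normalizer (S' : Set G) :=
          lt_of_le_of_ne (le_inf hR Subgroup.le_normalizer) (fun h => hv2 (h ▸ ⟨hv1, hv3⟩))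
        have h2 := card_lt_card_of_lt hlt
        have h3 : Nat.card S' = p ^ a U := by
          rw [hS', Subgroup.card_map_of_injective (Subgroup.subtype_injective _)]
          exact S.card_eq_multiplicity
        rw [hb, h3] at h2
        exact lt_of_lt_of_le ((Nat.pow_lt_pow_iff_right hp.out.one_lt).1 h2) h1
  refine ⟨U, Subgroup.normalizer_eq_top_iff.1 htop, hU1, hU2, ?_⟩
  intro C hC hUC hPC
  apply m2 C hC hUC
  have h1 := le_fact hPC P.card_eq_multiplicity
  refine le_trans ?_ h1
  simp only [a]
  rw [htop, Subgroup.card_top]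

structure Setup {G : Type u} [Group G] [Finite G] (p : ℕ) [Fact p.Prime] (P : Sylow p G)
    (U : Subgroup G) [U.Normal] (N : Subgroup (G ⧸ U)) : Prop where
  hyp : Hyp p P
  hnot : ¬ PNil p G
  hU : IsPGroup p U
  hW : ∀ W : Subgroup G, W.Normal → IsPGroup p W → W ≤ U
  hH : ∀ (Q : Sylow p G) (H : Subgroup G), (Q : Subgroup G) ≤ H → H ≠ ⊤ → PNil p H
  hN : ∀ M : Subgroup G, M.Normal → PNil p M → M ≤ U
  hPC : IsPC p N

lemma exists_setup {G : Type u} [Group G] [Finite G] (ih : IHyp.{u} p (Nat.card G))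
    (P : Sylow p G) (hP : Hyp p P) (hnot : ¬ PNil p G) :
    ∃ (U : Subgroup G) (_ : U.Normal) (N : Subgroup (G ⧸ U)), Setup p P U N := by
  obtain ⟨U, hUn, hU, hU0, hmax⟩ := exists_U ih P hP hnot
  have hUP : U ≤ P := hU.le_sylow_of_normal P
  have hW : ∀ W : Subgroup G, W.Normal → IsPGroup p W → W ≤ U := by
    intro W hWn hWp
    by_contra hle
    have hlt : U < U ⊔ W := lt_of_le_of_ne le_sup_left (fun h => hle (h ▸ le_sup_right))
    have hn : Subgroup.normalizer ((U ⊔ W : Subgroup G) : Set G) = ⊤ :=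
      Subgroup.normalizer_eq_top_iff.2 inferInstance
    have := hmax (U ⊔ W) (hU.to_sup_of_normal_right hWp) hlt (by rw [hn]; exact le_top)
    rw [hn] at this
    exact hnot this.of_top
  have hL : ∀ L : Subgroup G, L.Normal → (Nat.card L).Coprime p → L = ⊥ := by
    intro L hLn hLc
    by_contra hL0
    exact hnot (PNil.of_quotient L hLc (ih _ (card_quot_lt hL0) _ (hP.quot L hLc)))
  have hUneP : U ≠ P := by
    intro h
    have h1 := hP ⊤ inferInstance (by
      intro h2
      have : (P : Subgroup G) = ⊥ := by
        have := congrArg (Subgroup.map (P : Subgroup G).subtype) h2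
        rw [← MonoidHom.range_eq_map, Subgroup.range_subtype, Subgroup.map_bot] at this
        exact this
      exact hU0 (h.trans this))
    rw [← MonoidHom.range_eq_map, Subgroup.range_subtype, ← h,
      Subgroup.normalizer_eq_top_iff.2 hUn] at h1
    exact hnot h1.of_top
  have hquot : PNil p (G ⧸ U) := by
    refine ih _ (card_quot_lt hU0) (P.mapSurjective (QuotientGroup.mk'_surjective U)) ?_
    suffices haux : ∀ Pb : Subgroup (G ⧸ U), Pb = (P : Subgroup G).map (QuotientGroup.mk' U) →
        ∀ C : Subgroup Pb, C.Characteristic → C ≠ ⊥ →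
        PNil p (Subgroup.normalizer (C.map Pb.subtype : Set (G ⧸ U))) from haux _ rfl
    intro Pb hPb' C hC hC0
    have hPbp : IsPGroup p Pb := by rw [hPb']; exact P.2.map _
    set Cb := C.map Pb.subtype with hCb
    have hCb0 : Cb ≠ ⊥ := by
      rwa [Ne, Subgroup.map_eq_bot_iff_of_injective _ Pb.subtype_injective]
    set X := Cb.comap (QuotientGroup.mk' U) with hX
    have hcn : X.map (QuotientGroup.mk' U) = Cb :=
      Subgroup.map_comap_eq_self_of_surjective (QuotientGroup.mk'_surjective U) Cb
    have hnX := Subgroup.comap_normalizer_eq_of_surjective Cb (QuotientGroup.mk'_surjective U)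
    have h1 : PNil p (Subgroup.normalizer (X : Set G)) := by
      apply hmax
      · have hCp : IsPGroup p Cb :=
          (hPbp.to_subgroup C).map _
        apply hCp.comap_of_ker_isPGroup
        rw [QuotientGroup.ker_mk']; exact hU
      · refine lt_of_le_of_ne (QuotientGroup.le_comap_mk' U Cb) ?_
        intro h
        apply hCb0
        rw [← hcn, ← h, Subgroup.map_eq_bot_iff, QuotientGroup.ker_mk']
      · rw [hX, ← hnX, ← Subgroup.map_le_iff_le_comap, ← hPb']
        exact Subgroup.le_normalizer.trans (normalizer_le_char Pb C hC)
    rw [hX, ← hnX] at h1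
    have h2 := h1.map (QuotientGroup.mk' U)
    rw [Subgroup.map_comap_eq_self_of_surjective (QuotientGroup.mk'_surjective U)] at h2
    exact h2
  obtain ⟨N, hN⟩ := hquot
  refine ⟨U, hUn, N, hP, hnot, hU, hW, ?_, ?_, hN⟩
  · intro Q H hQH hne
    refine ih _ (card_lt_of_ne_top hne) (Q.subtype hQH) (Hyp.of_map _ Q ?_ (hP.conj Q))
    change (Subgroup.subgroupOf (Q : Subgroup G) H).map H.subtype = Q
    exact Subgroup.map_subgroupOf_eq_of_le hQH
  · intro M hM hMp
    obtain ⟨L, h1, h2, h3, k, hk⟩ := hMp.exists_normal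
    rw [hL L h1 h3, Subgroup.relIndex_bot_left] at hk
    exact hW M hM (IsPGroup.of_card hk)

end PartD


section PartD

variable {p : ℕ} [hp : Fact p.Prime]

lemma eq_bot_of_p_p' {G : Type*} [Group G] [Finite G] {M : Subgroup G} (h1 : IsPGroup p M)
    (h2 : (Nat.card M).Coprime p) : M = ⊥ := by
  obtain ⟨n, hn⟩ := IsPGroup.iff_card.1 h1
  rw [← Subgroup.card_eq_one]
  have := h2.pow_right n
  rw [← hn] at this
  exact (Nat.coprime_self _).1 this

lemma coprime_of_le {G : Type*} [Group G] {M N : Subgroup G} (h : M ≤ N)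
    (h2 : (Nat.card N).Coprime p) : (Nat.card M).Coprime p :=
  Nat.Coprime.coprime_dvd_left (Subgroup.card_dvd_of_le h) h2

namespace Setup

variable {G : Type u} [Group G] [Finite G] {P : Sylow p G} {U : Subgroup G} [U.Normal]
  {N : Subgroup (G ⧸ U)}

lemma U_le (s : Setup p P U N) : U ≤ P := s.hU.le_sylow_of_normal P

/-- p-subgroups of the preimage of N are contained in U -/
lemma p_le (s : Setup p P U N) (T : Subgroup G) (hT : IsPGroup p T)
    (hle : T ≤ N.comap (QuotientGroup.mk' U)) : T ≤ U := by
  have h1 : T.map (QuotientGroup.mk' U) = ⊥ :=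
    eq_bot_of_p_p' (hT.map _) (coprime_of_le (Subgroup.map_le_iff_le_comap.2 hle) s.hPC.2.1)
  rw [Subgroup.map_eq_bot_iff, QuotientGroup.ker_mk'] at h1
  exact h1

lemma centralizer_le (s : Setup p P U N) : Subgroup.centralizer (U : Set G) ≤ U := by
  have := s.hPC.1
  set K := N.comap (QuotientGroup.mk' U) with hK
  set C := Subgroup.centralizer (U : Set G) with hC
  have h1 : PNil p (C ⊓ K : Subgroup G) := by
    obtain ⟨T⟩ : Nonempty (Sylow p (C ⊓ K : Subgroup G)) := inferInstance
    apply PNil.of_central_sylow T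
    intro g hg y
    have hgU : (g : G) ∈ U := by
      apply s.p_le ((T : Subgroup (C ⊓ K : Subgroup G)).map (Subgroup.subtype _)) (T.2.map _)
      · exact (Subgroup.map_subtype_le _).trans inf_le_right
      · exact ⟨g, hg, rfl⟩
    have hy : (y : G) ∈ Subgroup.centralizer (U : Set G) := y.2.1
    exact Subtype.ext ((Subgroup.mem_centralizer_iff.1 hy) g hgU).symm
  have hCn : C.Normal := by rw [hC]; infer_instance
  have h2 := s.hN (C ⊓ K) inferInstance h1
  apply s.hW C hCn
  intro c
  obtain ⟨k, hk⟩ := s.hPC.2.2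
  have h3 : (c : G) ^ p ^ k ∈ K := by
    rw [hK, Subgroup.mem_comap, map_pow, ← hk]
    exact Subgroup.pow_index_mem N _
  have h4 : (c : G) ^ p ^ k ∈ U := h2 ⟨C.pow_mem c.2 _, h3⟩
  obtain ⟨j, hj⟩ := s.hU ⟨_, h4⟩
  refine ⟨k + j, ?_⟩
  have h5 : ((c : G) ^ p ^ k) ^ p ^ j = 1 := congrArg Subtype.val hj
  rw [← pow_mul, ← pow_add] at h5
  exact Subtype.ext h5

lemma N_ne_bot (s : Setup p P U N) : N ≠ ⊥ := by
  intro h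
  apply s.hnot
  obtain ⟨k, hk⟩ := s.hPC.2.2
  rw [h, Subgroup.index_bot] at hk
  obtain ⟨j, hj⟩ := IsPGroup.iff_card.1 s.hU
  apply PNil.of_isPGroup
  apply IsPGroup.of_card (n := j + k)
  rw [← Subgroup.card_mul_index U, hj, Subgroup.index_eq_card, hk, pow_add]

lemma N_min (s : Setup p P U N) (M : Subgroup (G ⧸ U)) (hM : M.Normal) (hMN : M ≤ N)
    (hM0 : M ≠ ⊥) : M = N := by
  set L := M.comap (QuotientGroup.mk' U) with hL
  have hUL : U ≤ L := QuotientGroup.le_comap_mk' U M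
  have hLU : ¬ L ≤ U := by
    intro h
    apply hM0
    rw [← Subgroup.map_comap_eq_self_of_surjective (QuotientGroup.mk'_surjective U) M,
      Subgroup.map_eq_bot_iff, QuotientGroup.ker_mk']
    exact h
  have hsup : (P : Subgroup G) ⊔ L = ⊤ := by
    by_contra hne
    have := s.hH P _ le_sup_left hne
    exact hLU (s.hN L inferInstance (this.mono le_sup_right))
  have h1 : M.index ∣ Nat.card P := by
    have e1 : M.index = L.index :=
      (Subgroup.index_comap_of_surjective M (QuotientGroup.mk'_surjective U)).symm
    rw [e1, ← Subgroup.relIndex_top_right, ← hsup, Subgroup.relIndex_sup_right]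
    exact Subgroup.relIndex_dvd_card L P
  obtain ⟨n, hn⟩ := IsPGroup.iff_card.1 P.2
  have h2 : M.relIndex N ∣ p ^ n := by
    refine dvd_trans ?_ (h1.trans hn.dvd)
    exact Subgroup.relIndex_dvd_index_of_normal M N
  have h3 : M.relIndex N ∣ Nat.card N := Subgroup.relIndex_dvd_card M N
  have h4 := Nat.eq_one_of_dvd_coprimes (s.hPC.2.1.pow_right n) h3 h2
  exact le_antisymm hMN (Subgroup.relIndex_eq_one.1 h4)

lemma sylow_normal (s : Setup p P U N) {q : ℕ} [Fact q.Prime] (Q : Sylow q N)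
    (hQ : ((Q : Subgroup N).map N.subtype) ≠ ⊥) : ((Q : Subgroup N).map N.subtype).Normal := by
  have := s.hPC.1
  set T := (Q : Subgroup N).map N.subtype with hT
  have hTN : T ≤ N := Subgroup.map_subtype_le _
  by_contra hn
  have hne : Subgroup.normalizer (T : Set (G ⧸ U)) ≠ ⊤ :=
    fun h => hn (Subgroup.normalizer_eq_top_iff.1 h)
  have hsup : Subgroup.normalizer (T : Set (G ⧸ U)) ⊔ N = ⊤ := Q.normalizer_sup_eq_top
  set H := (Subgroup.normalizer (T : Set (G ⧸ U))).comap (QuotientGroup.mk' U) with hH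
  have hsurj := QuotientGroup.mk'_surjective U
  have hHtop : H ≠ ⊤ := by
    intro h
    apply hne
    rw [← Subgroup.map_comap_eq_self_of_surjective hsurj (Subgroup.normalizer (T : Set (G ⧸ U))),
      ← hH, h, Subgroup.map_top_of_surjective _ hsurj]
  have hidx : H.index ∣ Nat.card N := by
    rw [hH, Subgroup.index_comap_of_surjective _ hsurj]
    have e1 := Subgroup.card_mul_index (Subgroup.normalizer (T : Set (G ⧸ U)))
    have e2 := Subgroup.card_mul_index N
    have e3 : N.index ∣ Nat.card (Subgroup.normalizer (T : Set (G ⧸ U))) := by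
      rw [← Subgroup.relIndex_top_right, ← hsup, Subgroup.relIndex_sup_right]
      exact Subgroup.relIndex_dvd_card _ _
    obtain ⟨t, ht⟩ := e3
    have hpos : 0 < N.index := Nat.pos_of_ne_zero Subgroup.index_ne_zero_of_finite
    refine ⟨t, Nat.eq_of_mul_eq_mul_left hpos ?_⟩
    rw [mul_comm, e2, ← e1, ht]; ring
  have hpidx : ¬ p ∣ H.index := fun hd =>
    (Nat.Prime.coprime_iff_not_dvd hp.out).1 s.hPC.2.1.symm (hd.trans hidx)
  obtain ⟨S⟩ : Nonempty (Sylow p H) := inferInstance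
  obtain ⟨R, hR⟩ := exists_sylow_of_index H hpidx S
  have hHnil : PNil p H := s.hH R H (by rw [hR]; exact Subgroup.map_subtype_le _) hHtop
  set L := T.comap (QuotientGroup.mk' U) with hL
  have hLnil : PNil p L := hHnil.mono (Subgroup.comap_mono Subgroup.le_normalizer)
  obtain ⟨M, hM1, -, hM3, ⟨k, hk⟩, hM5⟩ := hLnil.exists_rel
  have hUL : U ≤ L := QuotientGroup.le_comap_mk' U T
  have hcomm := comm_of_coprime (X := L) hM3 s.hU hM1 hUL (by
    intro g hg
    rw [Subgroup.mem_normalizer_iff]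
    intro m
    refine ⟨hM5 g (Subgroup.le_normalizer hg) m, fun h => ?_⟩
    have := hM5 g⁻¹ (Subgroup.le_normalizer (L.inv_mem hg)) _ h
    simpa [mul_assoc] using this) (by
    rw [Subgroup.normalizer_eq_top_iff.2 ‹U.Normal›]; exact le_top)
  have hMU : M ≤ U := by
    refine le_trans ?_ s.centralizer_le
    intro m hm
    rw [Subgroup.mem_centralizer_iff]
    intro u hu
    exact (hcomm m hm u hu).symm
  have hM0 : M = ⊥ := eq_bot_of_p_p' (s.hU.to_le hMU) hM3
  rw [hM0, Subgroup.relIndex_bot_left] at hk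
  have hLp : IsPGroup p L := IsPGroup.of_card hk
  have hTp : IsPGroup p T := by
    have := hLp.map (QuotientGroup.mk' U)
    rwa [hL, Subgroup.map_comap_eq_self_of_surjective hsurj] at this
  exact hQ (eq_bot_of_p_p' hTp (coprime_of_le hTN s.hPC.2.1))

lemma N_comm (s : Setup p P U N) : ∀ a b : N, a * b = b * a := by
  have := s.hPC.1
  have hne : Nat.card N ≠ 1 := by
    rw [Ne, Subgroup.card_eq_one]; exact s.N_ne_bot
  obtain ⟨q, hq, hqd⟩ := Nat.exists_prime_and_dvd hne
  have : Fact q.Prime := ⟨hq⟩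
  obtain ⟨Q⟩ : Nonempty (Sylow q N) := inferInstance
  have hQ0 : ((Q : Subgroup N).map N.subtype) ≠ ⊥ := by
    rw [Ne, Subgroup.map_eq_bot_iff_of_injective _ N.subtype_injective]
    exact Q.ne_bot_of_dvd_card hqd
  have hQN := s.N_min _ (s.sylow_normal Q hQ0) (Subgroup.map_subtype_le _) hQ0
  have hNq : IsPGroup q N := by
    rw [← hQN]; exact Q.2.map _
  have : Nontrivial N := (Subgroup.nontrivial_iff_ne_bot _).2 s.N_ne_bot
  have hc : (Subgroup.center N) ≠ ⊥ := hNq.bot_lt_center.ne'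
  have hZ := s.N_min ((Subgroup.center N).map N.subtype) inferInstance (Subgroup.map_subtype_le _)
    (by rwa [Ne, Subgroup.map_eq_bot_iff_of_injective _ N.subtype_injective])
  intro a b
  have ha : (a : G ⧸ U) ∈ (Subgroup.center N).map N.subtype := by rw [hZ]; exact a.2
  obtain ⟨z, hz, hza⟩ := ha
  have : z = a := Subtype.ext hza
  rw [this] at hz
  exact ((Subgroup.mem_center_iff.1 hz) b).symm

lemma cent_N (s : Setup p P U N) (a : G ⧸ U) (ha : a ∈ (P : Subgroup G).map (QuotientGroup.mk' U))
    (hc : ∀ k ∈ N, a * k = k * a) : a = 1 := by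
  have := s.hPC.1
  set Pb := (P : Subgroup G).map (QuotientGroup.mk' U) with hPb
  set D := Pb ⊓ Subgroup.centralizer (N : Set (G ⧸ U)) with hD
  have hsup : N ⊔ Pb = ⊤ := s.hPC.sup_sylow (P.mapSurjective (QuotientGroup.mk'_surjective U))
  have hDn : D.Normal := by
    rw [← Subgroup.normalizer_eq_top_iff, eq_top_iff, ← hsup, sup_le_iff]
    constructor
    · intro k hk
      rw [Subgroup.mem_normalizer_iff]
      have key : ∀ k ∈ N, ∀ d ∈ D, k * d * k⁻¹ ∈ D := by
        intro k hk d hd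
        have h1 := (Subgroup.mem_centralizer_iff.1 hd.2) k hk
        rw [h1]
        simpa using hd
      intro d
      refine ⟨key k hk d, fun h => ?_⟩
      have := key k⁻¹ (N.inv_mem hk) _ h
      simpa [mul_assoc] using this
    · have hcn : (Subgroup.centralizer (N : Set (G ⧸ U))).Normal := inferInstance
      have key : ∀ k ∈ Pb, ∀ d ∈ D, k * d * k⁻¹ ∈ D := by
        intro k hk d hd
        exact ⟨Pb.mul_mem (Pb.mul_mem hk hd.1) (Pb.inv_mem hk), hcn.conj_mem d hd.2 k⟩
      intro k hk
      rw [Subgroup.mem_normalizer_iff]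
      intro d
      refine ⟨key k hk d, fun h => ?_⟩
      have := key k⁻¹ (Pb.inv_mem hk) _ h
      simpa [mul_assoc] using this
  have hDp : IsPGroup p D := (P.2.map (QuotientGroup.mk' U)).to_le inf_le_left
  have hle := s.hW (D.comap (QuotientGroup.mk' U)) inferInstance
    (hDp.comap_of_ker_isPGroup _ (by rw [QuotientGroup.ker_mk']; exact s.hU))
  have haD : a ∈ D := ⟨ha, Subgroup.mem_centralizer_iff.2 fun k hk => (hc k hk).symm⟩
  obtain ⟨g, rfl⟩ := QuotientGroup.mk'_surjective U a
  exact (QuotientGroup.eq_one_iff g).2 (hle haD)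

/-- The elementary abelian normal subgroup. -/
lemma exists_V (s : Setup p P U N) : ∃ V : Subgroup G, V.Normal ∧ V ≤ U ∧
    (∀ a ∈ V, ∀ b ∈ V, a * b = b * a) ∧ (∀ a ∈ V, a ^ p = 1) ∧
    (∀ g : G, (∀ v ∈ V, g * v = v * g) ↔ g ∈ U) := by
  have hUC := s.centralizer_le
  let Z0 : Subgroup (P : Subgroup G) :=
    { carrier := {z | z ∈ Subgroup.center (P : Subgroup G) ∧ z ^ p = 1}
      mul_mem' := by
        rintro a b ⟨ha1, ha2⟩ ⟨hb1, hb2⟩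
        refine ⟨Subgroup.mul_mem _ ha1 hb1, ?_⟩
        have : Commute a b := (Subgroup.mem_center_iff.1 hb1 a)
        rw [this.mul_pow, ha2, hb2, one_mul]
      one_mem' := ⟨Subgroup.one_mem _, one_pow p⟩
      inv_mem' := by
        rintro a ⟨ha1, ha2⟩
        exact ⟨Subgroup.inv_mem _ ha1, by rw [inv_pow, ha2, inv_one]⟩ }
  have hZmem : ∀ z, z ∈ Z0 ↔ z ∈ Subgroup.center (P : Subgroup G) ∧ z ^ p = 1 := fun z => Iff.rfl
  have hPne : (P : Subgroup G) ≠ ⊥ := by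
    intro h
    apply s.hnot
    apply PNil.of_central_sylow P
    intro g hg y
    rw [h, Subgroup.mem_bot] at hg
    simp [hg]
  have hZchar : Z0.Characteristic := by
    rw [Subgroup.characteristic_iff_map_le]
    intro φ
    rintro _ ⟨z, hz, rfl⟩
    have hz' := (hZmem z).1 hz
    rw [hZmem]
    constructor
    · have := (Subgroup.characteristic_iff_map_le.1
        (inferInstance : (Subgroup.center (P : Subgroup G)).Characteristic)) φ
      exact this ⟨z, hz'.1, rfl⟩
    · rw [← map_pow, hz'.2, map_one]
  have hZ0 : Z0 ≠ ⊥ := by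
    have : Nontrivial (P : Subgroup G) := (Subgroup.nontrivial_iff_ne_bot _).2 hPne
    have h1 : Subgroup.center (P : Subgroup G) ≠ ⊥ := P.2.bot_lt_center.ne'
    obtain ⟨n, hn⟩ := IsPGroup.iff_card.1 (P.2.to_subgroup (Subgroup.center (P : Subgroup G)))
    have h2 : p ∣ Nat.card (Subgroup.center (P : Subgroup G)) := by
      rw [hn]
      apply dvd_pow_self
      rintro rfl
      rw [pow_zero, Subgroup.card_eq_one] at hn
      exact h1 hn
    obtain ⟨z, hz⟩ := exists_prime_orderOf_dvd_card' p h2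
    intro h
    have h3 : (z : (P : Subgroup G)) ∈ Z0 := by
      refine ⟨z.2, ?_⟩
      have := pow_orderOf_eq_one z
      rw [hz] at this
      exact congrArg Subtype.val this
    rw [h, Subgroup.mem_bot] at h3
    have h4 : z = 1 := Subtype.ext h3
    rw [h4, orderOf_one] at hz
    exact hp.out.one_lt.ne hz
  let Ω : Subgroup G :=
    { carrier := {z | z ∈ Subgroup.centralizer (U : Set G) ∧ z ^ p = 1}
      mul_mem' := by
        rintro a b ⟨ha1, ha2⟩ ⟨hb1, hb2⟩
        refine ⟨Subgroup.mul_mem _ ha1 hb1, ?_⟩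
        have : Commute a b := (Subgroup.mem_centralizer_iff.1 hb1 a (hUC ha1))
        rw [this.mul_pow, ha2, hb2, one_mul]
      one_mem' := ⟨Subgroup.one_mem _, one_pow p⟩
      inv_mem' := by
        rintro a ⟨ha1, ha2⟩
        exact ⟨Subgroup.inv_mem _ ha1, by rw [inv_pow, ha2, inv_one]⟩ }
  have hΩ : Ω.Normal := by
    constructor
    rintro z ⟨hz1, hz2⟩ g
    refine ⟨(inferInstance : (Subgroup.centralizer (U : Set G)).Normal).conj_mem z hz1 g, ?_⟩
    rw [conj_pow, hz2]; simp
  set Z := Z0.map (P : Subgroup G).subtype with hZ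
  have hZΩ : Z ≤ Ω := by
    rintro _ ⟨z, ⟨hz1, hz2⟩, rfl⟩
    constructor
    · rw [Subgroup.mem_centralizer_iff]
      intro u hu
      exact congrArg Subtype.val (Subgroup.mem_center_iff.1 hz1 ⟨u, s.U_le hu⟩)
    · exact congrArg Subtype.val hz2
  set V := Subgroup.normalClosure (Z : Set G) with hV
  have hVΩ : V ≤ Ω := Subgroup.normalClosure_le_normal hZΩ
  have hVC : V ≤ Subgroup.centralizer (U : Set G) := fun v hv => (hVΩ hv).1
  have hVU : V ≤ U := hVC.trans hUC
  have hZV : Z ≤ V := Subgroup.subset_normalClosure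
  refine ⟨V, Subgroup.normalClosure_normal, hVU, ?_, fun a ha => (hVΩ ha).2, ?_⟩
  · intro a ha b hb
    exact Subgroup.mem_centralizer_iff.1 (hVC hb) a (hVU ha)
  · intro g
    constructor
    · intro h
      have hVn : V.Normal := Subgroup.normalClosure_normal
      have h1 : PNil p (Subgroup.centralizer (V : Set G)) := by
        refine (s.hyp Z0 hZchar hZ0).mono ?_
        refine le_trans (Subgroup.centralizer_le hZV) ?_
        intro c hc
        rw [Subgroup.mem_centralizer_iff] at hc
        have key : ∀ z ∈ Z, c * z * c⁻¹ = z := by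
          intro z hz
          rw [← hc z hz]; group
        rw [Subgroup.mem_normalizer_iff]
        intro z
        constructor
        · intro hz
          rw [key z hz]; exact hz
        · intro hz
          have h2 := key _ hz
          have h3 : c * z * c⁻¹ = z := by
            have : c * (c * z * c⁻¹) * c⁻¹ = c * z * c⁻¹ := h2
            have h4 := mul_right_cancel this
            exact mul_left_cancel h4
          rw [h3] at hz; exact hz
      refine s.hN _ inferInstance h1 ?_
      rw [Subgroup.mem_centralizer_iff]
      intro v hv
      exact (h v hv).symm
    · intro hg v hv
      exact Subgroup.mem_centralizer_iff.1 (hVC hv) g hg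

end Setup

end PartD


section PartD

variable {p : ℕ} [hp : Fact p.Prime]

lemma final_count (hp3 : 3 ≤ p) {Γ W : Type*} [Group Γ] [Finite Γ] [AddCommGroup W]
    [Module (ZMod p) W] [Finite W] (R : Γ →* Module.End (ZMod p) W) (hR : Function.Injective R)
    (A K : Subgroup Γ) (hA : ∀ a b : A, a * b = b * a) (hA0 : A ≠ ⊥) (hKn : K.Normal)
    (hK : ∀ a b : K, a * b = b * a) (hKc : (Nat.card K).Coprime p)
    (hf : ∀ a ∈ A, (∀ k ∈ K, a * k = k * a) → a = 1)
    (I : Submodule (ZMod p) W) (hI : ∀ v ∈ I, ∀ a ∈ A, R a v = v) :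
    Nat.card A * Nat.card I < Nat.card W := by
  have : Nontrivial A := (Subgroup.nontrivial_iff_ne_bot _).2 hA0
  refine weight_zmod hp3 hA hK ((Nat.Prime.coprime_iff_not_dvd hp.out).1 hKc.symm)
    (R.comp A.subtype) (R.comp K.subtype) ((MulAut.conjNormal (H := K)).comp A.subtype) ?_ ?_ I ?_
  · intro a g
    simp only [MonoidHom.comp_apply]
    rw [← map_mul, ← map_mul]
    congr 1
    simp [MulAut.conjNormal_apply]
  · intro a h
    apply Subtype.ext
    refine hf a a.2 ?_
    intro k hk
    have := h ⟨k, hk⟩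
    apply hR
    rw [map_mul, map_mul]
    exact this
  · intro v hv a
    exact hI v hv a a.2

lemma exists_rep {Γ V : Type*} [Group Γ] [CommGroup V] [Module (ZMod p) (Additive V)]
    (R : Γ →* MulAut V) : ∃ R' : Γ →* Module.End (ZMod p) (Additive V),
      ∀ g (x : Additive V), R' g x = Additive.ofMul (R g x.toMul) := by
  let F : Γ → Module.End (ZMod p) (Additive V) :=
    fun g => AddMonoidHom.toZModLinearMap p (MonoidHom.toAdditive (R g).toMonoidHom)
  have hF : ∀ g (x : Additive V), F g x = Additive.ofMul (R g x.toMul) := fun g x => rfl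
  have h1 : F 1 = 1 := by
    apply LinearMap.ext
    intro x
    rw [hF, map_one, Module.End.one_apply]
    rfl
  have h2 : ∀ a b, F (a * b) = F a * F b := by
    intro a b
    apply LinearMap.ext
    intro x
    rw [hF, map_mul, Module.End.mul_apply, hF, hF]
    rfl
  exact ⟨⟨⟨F, h1⟩, h2⟩, hF⟩

lemma final_count_mul (hp3 : 3 ≤ p) {Γ V : Type*} [Group Γ] [Finite Γ] [CommGroup V] [Finite V]
    (hexp : ∀ v : V, v ^ p = 1) (R : Γ →* MulAut V) (hR : Function.Injective R)
    (A K : Subgroup Γ) (hA : ∀ a b : A, a * b = b * a) (hA0 : A ≠ ⊥) (hKn : K.Normal)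
    (hK : ∀ a b : K, a * b = b * a) (hKc : (Nat.card K).Coprime p)
    (hf : ∀ a ∈ A, (∀ k ∈ K, a * k = k * a) → a = 1)
    (I : Subgroup V) (hI : ∀ v ∈ I, ∀ a ∈ A, R a v = v) :
    Nat.card A * Nat.card I < Nat.card V := by
  letI : Module (ZMod p) (Additive V) := AddCommGroup.zmodModule (n := p) (by
    intro x
    exact hexp x.toMul)
  obtain ⟨R', hRapp⟩ := exists_rep (p := p) R
  have hR' : Function.Injective R' := by
    intro a b hab
    apply hR
    apply MulEquiv.ext
    intro v
    have h1 := hRapp a (Additive.ofMul v)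
    rw [hab, hRapp] at h1
    exact h1.symm
  exact final_count hp3 R' hR' A K hA hA0 hKn hK hKc hf
    (AddSubgroup.toZModSubmodule p (Subgroup.toAddSubgroup I)) (fun v hv a ha => (hRapp a v).trans (hI v.toMul hv a ha))

lemma final_count_grp (hp3 : 3 ≤ p) {Γ V : Type*} [Group Γ] [Finite Γ] [Group V] [Finite V]
    (hcomm : ∀ a b : V, a * b = b * a)
    (hexp : ∀ v : V, v ^ p = 1) (R : Γ →* MulAut V) (hR : Function.Injective R)
    (A K : Subgroup Γ) (hA : ∀ a b : A, a * b = b * a) (hA0 : A ≠ ⊥) (hKn : K.Normal)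
    (hK : ∀ a b : K, a * b = b * a) (hKc : (Nat.card K).Coprime p)
    (hf : ∀ a ∈ A, (∀ k ∈ K, a * k = k * a) → a = 1)
    (I : Subgroup V) (hI : ∀ v ∈ I, ∀ a ∈ A, R a v = v) :
    Nat.card A * Nat.card I < Nat.card V := by
  letI cg : CommGroup V := { (inferInstance : Group V) with mul_comm := hcomm }
  exact final_count_mul hp3 hexp R hR A K hA hA0 hKn hK hKc hf I hI

/-- abelian subgroups of maximal order -/
def MaxAb {H : Type*} [Group H] (A : Subgroup H) : Prop :=
  (∀ a ∈ A, ∀ b ∈ A, a * b = b * a) ∧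
  ∀ B : Subgroup H, (∀ a ∈ B, ∀ b ∈ B, a * b = b * a) → Nat.card B ≤ Nat.card A

lemma exists_maxAb (H : Type*) [Group H] [Finite H] : ∃ A : Subgroup H, MaxAb A := by
  obtain ⟨A, hA, hmax⟩ := Set.exists_max_image
    {A : Subgroup H | ∀ a ∈ A, ∀ b ∈ A, a * b = b * a} (fun A => Nat.card A) (Set.toFinite _)
    ⟨⊥, by
      intro a ha b hb
      rw [Subgroup.mem_bot] at ha hb
      rw [ha, hb]⟩
  exact ⟨A, hA, hmax⟩

lemma MaxAb.map {H : Type*} [Group H] [Finite H] {A : Subgroup H} (h : MaxAb A) (φ : H ≃* H) :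
    MaxAb (A.map φ.toMonoidHom) := by
  constructor
  · rintro _ ⟨a, ha, rfl⟩ _ ⟨b, hb, rfl⟩
    rw [← map_mul, ← map_mul, h.1 a ha b hb]
  · intro B hB
    rw [Subgroup.card_map_of_injective φ.injective]
    exact h.2 B hB

def JSub (H : Type*) [Group H] : Subgroup H := sSup {A : Subgroup H | MaxAb A}

lemma JSub_char (H : Type*) [Group H] [Finite H] : (JSub H).Characteristic := by
  rw [Subgroup.characteristic_iff_map_le]
  intro φ
  rw [JSub, Subgroup.map_le_iff_le_comap, sSup_le_iff]
  intro A hA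
  rw [← Subgroup.map_le_iff_le_comap]
  exact le_sSup (hA.map φ)

lemma JSub_ne_bot (H : Type*) [Group H] [Finite H] [Nontrivial H] : JSub H ≠ ⊥ := by
  intro h
  obtain ⟨A, hA⟩ := exists_maxAb H
  have h1 : A ≤ JSub H := le_sSup hA
  rw [h, le_bot_iff] at h1
  obtain ⟨x, hx⟩ := exists_ne (1 : H)
  have h2 := hA.2 (Subgroup.zpowers x) (by
    rintro _ ⟨i, rfl⟩ _ ⟨j, rfl⟩
    simp only
    rw [← zpow_add, ← zpow_add, add_comm])
  rw [h1, Subgroup.card_bot] at h2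
  have h3 : 1 < Nat.card (Subgroup.zpowers x) := by
    rw [Subgroup.one_lt_card_iff_ne_bot]
    simpa using hx
  omega

namespace Setup

variable {G : Type u} [Group G] [Finite G] {P : Sylow p G} {U : Subgroup G} [U.Normal]
  {N : Subgroup (G ⧸ U)}

/-- an abelian subgroup of `P` of maximal order which is not inside `U`. -/
lemma exists_A (s : Setup p P U N) : ∃ A : Subgroup G, A ≤ P ∧ (∀ a ∈ A, ∀ b ∈ A, a * b = b * a) ∧
    (∀ B : Subgroup G, B ≤ P → (∀ a ∈ B, ∀ b ∈ B, a * b = b * a) → Nat.card B ≤ Nat.card A) ∧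
    ¬ A ≤ U := by
  have hinj := (P : Subgroup G).subtype_injective
  have hsub : ∀ A : Subgroup (P : Subgroup G), MaxAb A →
      ∀ B : Subgroup G, B ≤ P → (∀ a ∈ B, ∀ b ∈ B, a * b = b * a) → Nat.card B ≤ Nat.card A := by
    intro A hA B hB hBc
    have h1 := hA.2 (B.subgroupOf P) (fun a ha b hb => Subtype.ext (hBc a ha b hb))
    have h2 : (B.subgroupOf (P : Subgroup G)).map (P : Subgroup G).subtype = B :=
      Subgroup.map_subgroupOf_eq_of_le hB
    rw [← h2, Subgroup.card_map_of_injective hinj]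
    exact h1
  by_contra hcon
  have hall : ∀ A : Subgroup (P : Subgroup G), MaxAb A → A.map (P : Subgroup G).subtype ≤ U := by
    intro A hA
    by_contra hAU
    refine hcon ⟨A.map (P : Subgroup G).subtype, Subgroup.map_subtype_le _, ?_, ?_, hAU⟩
    · rintro _ ⟨a, ha, rfl⟩ _ ⟨b, hb, rfl⟩
      rw [← map_mul, ← map_mul, hA.1 a ha b hb]
    · intro B hB hBc
      rw [Subgroup.card_map_of_injective hinj]
      exact hsub A hA B hB hBc
  have hUP := s.U_le
  have hPne : (P : Subgroup G) ≠ ⊥ := by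
    intro h
    apply s.hnot
    apply PNil.of_central_sylow P
    intro g hg y
    rw [h, Subgroup.mem_bot] at hg
    simp [hg]
  have : Nontrivial (P : Subgroup G) := (Subgroup.nontrivial_iff_ne_bot _).2 hPne
  have hJ := s.hyp (JSub (P : Subgroup G)) (JSub_char _) (JSub_ne_bot _)
  have hJn : ((JSub (P : Subgroup G)).map (P : Subgroup G).subtype).Normal := by
    constructor
    intro j hj g
    have hle : ((JSub (P : Subgroup G)).map (P : Subgroup G).subtype) ≤
        ((JSub (P : Subgroup G)).map (P : Subgroup G).subtype).comap (MulAut.conj g).toMonoidHom := by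
      rw [Subgroup.map_le_iff_le_comap]
      conv_lhs => rw [JSub]
      rw [sSup_le_iff]
      intro A hA
      rw [← Subgroup.map_le_iff_le_comap, ← Subgroup.map_le_iff_le_comap]
      set B := (A.map (P : Subgroup G).subtype).map (MulAut.conj g).toMonoidHom with hB
      have hBU : B ≤ U := by
        rw [hB, Subgroup.map_le_iff_le_comap]
        refine (hall A hA).trans ?_
        intro u hu
        exact (inferInstance : U.Normal).conj_mem u hu g
      have hBP : B ≤ P := hBU.trans hUP
      have hBeq : (B.subgroupOf (P : Subgroup G)).map (P : Subgroup G).subtype = B :=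
        Subgroup.map_subgroupOf_eq_of_le hBP
      have hBc : Nat.card (B.subgroupOf (P : Subgroup G)) = Nat.card A := by
        rw [← Subgroup.card_map_of_injective (K := B.subgroupOf (P : Subgroup G)) hinj, hBeq, hB,
          Subgroup.card_map_of_injective (MulAut.conj g).injective,
          Subgroup.card_map_of_injective hinj]
      have hBmax : MaxAb (B.subgroupOf (P : Subgroup G)) := by
        constructor
        · have hBcomm : ∀ a ∈ B, ∀ b ∈ B, a * b = b * a := by
            rintro _ ⟨_, ⟨a, ha, rfl⟩, rfl⟩ _ ⟨_, ⟨b, hb, rfl⟩, rfl⟩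
            rw [← map_mul, ← map_mul, ← map_mul, ← map_mul, hA.1 a ha b hb]
          exact fun a ha b hb => Subtype.ext (hBcomm a ha b hb)
        · intro X hX
          rw [hBc]; exact hA.2 X hX
      rw [← hBeq]
      exact Subgroup.map_mono (le_sSup hBmax)
    exact hle hj
  rw [Subgroup.normalizer_eq_top_iff.2 hJn] at hJ
  exact s.hnot hJ.of_top

lemma contra (s : Setup p P U N) (hp3 : 3 ≤ p) : False := by
  obtain ⟨V, hVn, hVU, hVc, hVp, hVcent⟩ := s.exists_V
  obtain ⟨A, hAP, hAc, hAmax, hAU⟩ := s.exists_A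
  have hUP := s.U_le
  -- the inequality
  have hineq : Nat.card V ≤ Nat.card (A.map (QuotientGroup.mk' U)) * Nat.card (A ⊓ V : Subgroup G) := by
    set B := (A ⊓ U) ⊔ V with hB
    have hBcard : Nat.card B ≤ Nat.card A := by
      apply hAmax
      · exact sup_le (inf_le_left.trans hAP) (hVU.trans hUP)
      · intro a ha b hb
        obtain ⟨a1, ha1, v1, hv1, rfl⟩ := Subgroup.mem_sup_of_normal_right.1 ha
        obtain ⟨b1, hb1, w1, hw1, rfl⟩ := Subgroup.mem_sup_of_normal_right.1 hb
        have e1 : Commute a1 b1 := hAc a1 ha1.1 b1 hb1.1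
        have e2 : Commute v1 w1 := hVc v1 hv1 w1 hw1
        have e3 : Commute a1 w1 := (hVcent a1).2 ha1.2 w1 hw1
        have e4 : Commute v1 b1 := ((hVcent b1).2 hb1.2 v1 hv1).symm
        exact ((e1.mul_right e3).mul_left (e4.mul_right e2)).eq
    have c1 := Subgroup.relIndex_mul_relIndex ⊥ V B bot_le le_sup_right
    rw [Subgroup.relIndex_bot_left, Subgroup.relIndex_bot_left, hB, Subgroup.relIndex_sup_right,
      ← hB] at c1
    have c2 : Nat.card (A ⊓ V : Subgroup G) * V.relIndex (A ⊓ U) = Nat.card (A ⊓ U : Subgroup G) := by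
      have := Subgroup.relIndex_mul_relIndex ⊥ (A ⊓ V) (A ⊓ U) bot_le
        (inf_le_inf_left A hVU)
      rw [Subgroup.relIndex_bot_left, Subgroup.relIndex_bot_left] at this
      rw [← this]
      congr 1
      rw [← Subgroup.inf_relIndex_right]
      congr 1
      rw [inf_comm, inf_assoc, inf_eq_right.2 hVU]
    have c3 : Nat.card (A ⊓ U : Subgroup G) * Nat.card (A.map (QuotientGroup.mk' U)) = Nat.card A := by
      have := Subgroup.relIndex_mul_relIndex ⊥ (A ⊓ U) A bot_le inf_le_left
      rw [Subgroup.relIndex_bot_left, Subgroup.relIndex_bot_left, Subgroup.inf_relIndex_left] at this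
      rw [← this]
      congr 1
      have h := Subgroup.relIndex_ker (QuotientGroup.mk' U) (K := A)
      rw [QuotientGroup.ker_mk'] at h
      exact h.symm
    have hpos : 0 < V.relIndex (A ⊓ U) := by
      apply Nat.pos_of_ne_zero
      intro h
      rw [h, mul_zero] at c2
      exact Nat.card_pos.ne c2
    rw [← c1, ← c3, ← c2] at hBcard
    refine Nat.le_of_mul_le_mul_right (hBcard.trans (le_of_eq ?_)) hpos
    ring
  -- the module
  let R : G →* MulAut V := MulAut.conjNormal (H := V)
  have hRapp : ∀ g (v : V), ((R g v : V) : G) = g * v * g⁻¹ :=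
    fun g v => MulAut.conjNormal_apply g v
  have hRker : R.ker = U := by
    ext g
    rw [MonoidHom.mem_ker, ← hVcent g]
    constructor
    · intro h v hv
      have h1 := hRapp g ⟨v, hv⟩
      rw [h] at h1
      exact (mul_inv_eq_iff_eq_mul.1 h1.symm)
    · intro h
      apply MulEquiv.ext
      intro x
      apply Subtype.ext
      rw [hRapp, h _ x.2]
      simp
  let Rb : G ⧸ U →* MulAut V :=
    QuotientGroup.lift U R (fun g hg => by rw [← hRker] at hg; exact hg)
  have hRb : Function.Injective Rb := by
    rw [injective_iff_map_eq_one]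
    intro a
    obtain ⟨g, rfl⟩ := QuotientGroup.mk'_surjective U a
    intro h
    have : R g = 1 := h
    apply (QuotientGroup.eq_one_iff g).2
    rw [← hRker]; exact this
  have hIcard : Nat.card ((A ⊓ V).subgroupOf V) = Nat.card (A ⊓ V : Subgroup G) :=
    Nat.card_congr (Subgroup.subgroupOfEquivOfLe inf_le_right).toEquiv
  have hfin := final_count_grp hp3 (fun a b => Subtype.ext (hVc a a.2 b b.2))
    (fun v => Subtype.ext (hVp v v.2)) Rb hRb (A.map (QuotientGroup.mk' U)) N ?_ ?_ s.hPC.1 s.N_comm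
    s.hPC.2.1 ?_ ((A ⊓ V).subgroupOf V) ?_
  · rw [hIcard] at hfin
    omega
  · rintro ⟨_, a, ha, rfl⟩ ⟨_, b, hb, rfl⟩
    apply Subtype.ext
    change QuotientGroup.mk' U a * QuotientGroup.mk' U b = QuotientGroup.mk' U b * QuotientGroup.mk' U a
    rw [← map_mul, ← map_mul, hAc a ha b hb]
  · rw [Ne, Subgroup.map_eq_bot_iff, QuotientGroup.ker_mk']
    exact hAU
  · intro a ha h
    exact s.cent_N a (Subgroup.map_mono hAP ha) h
  · rintro v hv _ ⟨a, ha, rfl⟩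
    have hv' : (v : G) ∈ A := (Subgroup.mem_subgroupOf.1 hv).1
    change R a v = v
    apply Subtype.ext
    rw [hRapp, hAc a ha _ hv']
    group

end Setup

theorem thompson_aux (hp3 : 3 ≤ p) : ∀ n : ℕ, IHyp.{u} p n := by
  intro n
  induction n with
  | zero => intro G _ _ h; exact absurd h (Nat.not_lt_zero _)
  | succ n ih =>
    intro G _ _ hc P hP
    by_contra hnot
    have ih' : IHyp.{u} p (Nat.card G) := by
      intro G' _ _ h' P' hP'
      exact ih G' (by omega) P' hP'
    obtain ⟨U, hU, N, s⟩ := exists_setup ih' P hP hnot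
    exact s.contra hp3

theorem thompson (hp3 : 3 ≤ p) {G : Type u} [Group G] [Finite G] (P : Sylow p G) (hP : Hyp p P) :
    PNil p G := thompson_aux hp3 (Nat.card G + 1) G (Nat.lt_succ_self _) P hP

end PartD



section PartE

def SolvP (G : Type*) [Group G] : Prop := Group.IsSolvable G

variable {p : ℕ} [hp : Fact p.Prime]

lemma SolvP.inj {G H : Type*} [Group G] [Group H] (h : SolvP G) (f : H →* G)
    (hf : Function.Injective f) : SolvP H := by
  have : Group.IsSolvable G := h
  exact Group.isSolvable_of_isSolvable_injective hf

lemma SolvP.surj {G H : Type*} [Group G] [Group H] (h : SolvP G) (f : G →* H)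
    (hf : Function.Surjective f) : SolvP H := by
  have : Group.IsSolvable G := h
  exact Group.isSolvable_of_surjective hf

lemma SolvP.mono {G : Type*} [Group G] {H K : Subgroup G} (h : SolvP K) (hle : H ≤ K) : SolvP H :=
  h.inj (Subgroup.inclusion hle) (Subgroup.inclusion_injective hle)

lemma SolvP.map {G G' : Type*} [Group G] [Group G'] {H : Subgroup G} (h : SolvP H) (f : G →* G') :
    SolvP (H.map f) :=
  h.surj (f.subgroupMap H) (f.subgroupMap_surjective H)

lemma SolvP.comap {G G' : Type*} [Group G] [Group G'] {H : Subgroup G'} (h : SolvP H) (f : G →* G')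
    (hk : SolvP f.ker) : SolvP (H.comap f) := by
  have : Group.IsSolvable H := h
  have : Group.IsSolvable f.ker := hk
  have hle : f.ker ≤ H.comap f := by
    intro a ha
    rw [Subgroup.mem_comap, ha]
    exact H.one_mem
  refine Group.isSolvable_of_ker_le_range (Subgroup.inclusion hle) (f.subgroupComap H) ?_
  intro a ha
  have : f a = 1 := congrArg Subtype.val ha
  exact ⟨⟨a, this⟩, rfl⟩

lemma SolvP.of_pgroup {q : ℕ} [Fact q.Prime] {G : Type*} [Group G] [Finite G] (h : IsPGroup q G) : SolvP G := by
  have := h.isNilpotent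
  exact (inferInstance : Group.IsSolvable G)

lemma SolvP.sup {G : Type*} [Group G] {A B : Subgroup G} (hA : SolvP A) (hB : SolvP B)
    (hAB : B ≤ Subgroup.normalizer (A : Set G)) : SolvP (A ⊔ B : Subgroup G) := by
  have hn : (A.subgroupOf (A ⊔ B)).Normal := by
    rw [Subgroup.normal_subgroupOf_iff_le_normalizer le_sup_left]
    exact sup_le Subgroup.le_normalizer hAB
  have h1 : SolvP (↥(A ⊔ B) ⧸ A.subgroupOf (A ⊔ B)) := by
    refine hB.surj ((QuotientGroup.mk' _).comp (Subgroup.inclusion le_sup_right)) ?_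
    intro y
    obtain ⟨⟨y, hy⟩, rfl⟩ := QuotientGroup.mk'_surjective _ y
    obtain ⟨b, hb, a, ha, rfl⟩ : ∃ b ∈ B, ∃ a ∈ A, b * a = y := by
      rw [sup_comm, ← SetLike.mem_coe, Subgroup.coe_mul_of_left_le_normalizer_right _ _ hAB] at hy
      exact hy
    refine ⟨⟨b, hb⟩, ?_⟩
    rw [MonoidHom.comp_apply]
    apply (QuotientGroup.eq).2
    rw [Subgroup.mem_subgroupOf]
    simpa using ha
  have : Group.IsSolvable (↥(A ⊔ B) ⧸ A.subgroupOf (A ⊔ B)) := h1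
  have : Group.IsSolvable A := hA
  refine Group.isSolvable_of_ker_le_range (Subgroup.inclusion (le_sup_left : A ≤ A ⊔ B))
    (QuotientGroup.mk' (A.subgroupOf (A ⊔ B))) ?_
  intro a ha
  rw [QuotientGroup.ker_mk', Subgroup.mem_subgroupOf] at ha
  exact ⟨⟨a, ha⟩, rfl⟩

lemma SolvP.zpowers {G : Type*} [Group G] (y : G) : SolvP (Subgroup.zpowers y) :=
  Group.isSolvable_of_comm (fun a b => mul_comm' a b)

/-- `H` is the set of `y` with `⟨x, y⟩` solvable -/
def IsSolSub {G : Type*} [Group G] (x : G) (H : Subgroup G) : Prop :=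
  ∀ y, y ∈ H ↔ SolvP (Subgroup.closure {x, y})

lemma IsSolSub.le {G : Type*} [Group G] {x : G} {H S : Subgroup G} (h : IsSolSub x H)
    (hS : SolvP S) (hx : x ∈ S) : S ≤ H := by
  intro y hy
  rw [h y]
  refine hS.mono ((Subgroup.closure_le _).2 ?_)
  rintro z (rfl | rfl)
  · exact hx
  · exact hy

lemma IsSolSub.self_mem {G : Type*} [Group G] {x : G} {H : Subgroup G} (h : IsSolSub x H) : x ∈ H :=
  h.le (SolvP.zpowers x) (Subgroup.mem_zpowers x) (Subgroup.mem_zpowers x)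

lemma IsSolSub.subgroupOf {G : Type*} [Group G] {x : G} {H : Subgroup G} (h : IsSolSub x H)
    (K : Subgroup G) (hx : x ∈ K) : IsSolSub (⟨x, hx⟩ : K) (H.subgroupOf K) := by
  intro y
  rw [Subgroup.mem_subgroupOf, h]
  have e : (Subgroup.closure {(⟨x, hx⟩ : K), y}).map K.subtype = Subgroup.closure {x, (y : G)} := by
    rw [MonoidHom.map_closure, Set.image_pair]; rfl
  rw [← e]
  let φ := Subgroup.equivMapOfInjective (Subgroup.closure {(⟨x, hx⟩ : K), y}) K.subtype K.subtype_injective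
  exact ⟨fun h => h.inj φ.toMonoidHom φ.injective, fun h => h.inj φ.symm.toMonoidHom φ.symm.injective⟩

lemma IsSolSub.quot {G : Type*} [Group G] {x : G} {H : Subgroup G} (h : IsSolSub x H)
    (L : Subgroup G) [L.Normal] (hL : SolvP L) :
    IsSolSub (QuotientGroup.mk' L x) (H.map (QuotientGroup.mk' L)) := by
  intro y
  have e : ∀ z, (Subgroup.closure {x, z}).map (QuotientGroup.mk' L) =
      Subgroup.closure {QuotientGroup.mk' L x, QuotientGroup.mk' L z} := by
    intro z
    rw [MonoidHom.map_closure, Set.image_pair]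
  constructor
  · rintro ⟨z, hz, rfl⟩
    rw [← e]
    exact ((h z).1 hz).map _
  · intro hy
    obtain ⟨z, rfl⟩ := QuotientGroup.mk'_surjective L y
    refine ⟨z, (h z).2 ?_, rfl⟩
    rw [← e] at hy
    exact (hy.comap _ (by rw [QuotientGroup.ker_mk']; exact hL)).mono (Subgroup.le_comap_map _ _)

lemma main_aux (hp3 : 3 ≤ p) (n : ℕ) : ∀ {G : Type u} [Group G] [Finite G], Nat.card G = n →
    ¬ SolvP G → ∀ (x : G) (H : Subgroup G), IsSolSub x H → IsPGroup p H → False := by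
  induction n using Nat.strong_induction_on with
  | _ n ih =>
  intro G _ _ hn hG x H hH hHp
  have hHsol : SolvP H := SolvP.of_pgroup hHp
  have hxH := hH.self_mem
  -- proper subgroups containing x are solvable
  have hprop : ∀ K : Subgroup G, x ∈ K → K ≠ ⊤ → K ≤ H := by
    intro K hx hK
    by_cases hs : SolvP K
    · exact hH.le hs hx
    · exact (ih (Nat.card K) (hn ▸ card_lt_of_ne_top hK) rfl hs ⟨x, hx⟩ _ (hH.subgroupOf K hx)
        (hHp.of_injective ((K.subtype).subgroupComap H) (by
          intro a b hab
          have : ((a : K) : G) = ((b : K) : G) :=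
            congrArg (fun z : H => (z : G)) hab
          exact Subtype.ext (Subtype.ext this)))).elim
  have hnorm : ∀ L : Subgroup G, L.Normal → SolvP L → L = ⊥ := by
    intro L hLn hL
    by_contra hne
    refine ih (Nat.card (G ⧸ L)) (hn ▸ card_quot_lt hne) rfl ?_ _ _ (hH.quot L hL) (hHp.map _)
    intro hs
    apply hG
    have : Group.IsSolvable L := hL
    have : Group.IsSolvable (G ⧸ L) := hs
    exact (Group.isSolvable_iff_subgroup_quotient L).2 ⟨‹_›, ‹_›⟩
  have hself : Subgroup.normalizer (H : Set G) ≤ H := by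
    intro y hy
    have h1 : SolvP (H ⊔ Subgroup.zpowers y : Subgroup G) :=
      hHsol.sup (SolvP.zpowers y) (by rwa [Subgroup.zpowers_le])
    exact hH.le h1 (Subgroup.mem_sup_left hxH) (Subgroup.mem_sup_right (Subgroup.mem_zpowers y))
  obtain ⟨P, hP⟩ := hHp.exists_le_sylow
  have hPH : (P : Subgroup G) = H := by
    by_contra hne
    obtain ⟨u, -, h1, h2⟩ := exists_mem_normalizer P.2 hP (Ne.symm hne)
    exact h1 (hself h2)
  have hyp : Hyp p P := by
    intro C hC hC0
    apply PNil.of_isPGroup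
    have hle : (P : Subgroup G) ≤ Subgroup.normalizer (C.map (P : Subgroup G).subtype : Set G) :=
      Subgroup.le_normalizer.trans (normalizer_le_char _ C hC)
    have : Subgroup.normalizer (C.map (P : Subgroup G).subtype : Set G) ≤ H := by
      refine hprop _ (hle (hP hxH)) ?_
      intro h
      have h1 := hnorm (C.map (P : Subgroup G).subtype) (Subgroup.normalizer_eq_top_iff.1 h)
        (SolvP.mono (K := (P : Subgroup G)) (SolvP.of_pgroup P.2) (Subgroup.map_subtype_le C))
      exact hC0 ((Subgroup.map_eq_bot_iff_of_injective _ (Subgroup.subtype_injective _)).1 h1)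
    exact hHp.to_le this
  obtain ⟨M, hMn, hMc, k, hk⟩ := thompson hp3 P hyp
  by_cases hM : M = ⊥
  · subst hM
    rw [Subgroup.index_bot] at hk
    exact hG (SolvP.of_pgroup (IsPGroup.of_card hk))
  have hM1 : Nat.card M ≠ 1 := fun h => hM (Subgroup.card_eq_one.1 h)
  obtain ⟨q, hq, hqM⟩ := Nat.exists_prime_and_dvd hM1
  have : Fact q.Prime := ⟨hq⟩
  obtain ⟨Q⟩ : Nonempty (Sylow q M) := inferInstance
  set T := (Q : Subgroup M).map M.subtype with hT
  have hTM : T ≤ M := Subgroup.map_subtype_le _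
  have hT0 : T ≠ ⊥ := by
    intro h
    have h1 : (Q : Subgroup M) = ⊥ :=
      (Subgroup.map_eq_bot_iff_of_injective _ M.subtype_injective).1 h
    exact Q.ne_bot_of_dvd_card hqM h1
  have hTq : IsPGroup q T := Q.2.map _
  have hsup : Subgroup.normalizer (T : Set G) ⊔ M = ⊤ := Q.normalizer_sup_eq_top
  have hidx : (Subgroup.normalizer (T : Set G)).index ∣ Nat.card M := by
    have e1 := Subgroup.card_mul_index (Subgroup.normalizer (T : Set G))
    have e2 := Subgroup.card_mul_index M
    have e3 : M.index ∣ Nat.card (Subgroup.normalizer (T : Set G)) := by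
      rw [← Subgroup.relIndex_top_right, ← hsup, Subgroup.relIndex_sup_right]
      exact Subgroup.relIndex_dvd_card _ _
    obtain ⟨t, ht⟩ := e3
    have hpos : 0 < M.index := Nat.pos_of_ne_zero Subgroup.index_ne_zero_of_finite
    refine ⟨t, Nat.eq_of_mul_eq_mul_left hpos ?_⟩
    rw [mul_comm, e2, ← e1, ht]; ring
  have hpidx : ¬ p ∣ (Subgroup.normalizer (T : Set G)).index := fun hd =>
    (Nat.Prime.coprime_iff_not_dvd hp.out).1 hMc.symm (hd.trans hidx)
  obtain ⟨S⟩ : Nonempty (Sylow p (Subgroup.normalizer (T : Set G))) := inferInstance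
  obtain ⟨R, hR⟩ := exists_sylow_of_index _ hpidx S
  have hRN : (R : Subgroup G) ≤ Subgroup.normalizer (T : Set G) := by
    rw [hR]; exact Subgroup.map_subtype_le _
  obtain ⟨g, hg⟩ := MulAction.exists_smul_eq G R P
  have hPR : (P : Subgroup G) = (R : Subgroup G).map (MulAut.conj g).toMonoidHom := by
    rw [← hg]; rfl
  set T' := T.map (MulAut.conj g).toMonoidHom with hT'
  have hPN : (P : Subgroup G) ≤ Subgroup.normalizer (T' : Set G) := by
    rw [hPR, hT']
    exact (Subgroup.map_mono hRN).trans (Subgroup.le_normalizer_map _)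
  have hT'q : IsPGroup q T' := hTq.map _
  have hsol : SolvP (T' ⊔ (P : Subgroup G) : Subgroup G) :=
    (SolvP.of_pgroup hT'q).sup (SolvP.of_pgroup P.2) hPN
  have hle : T' ≤ H := le_sup_left.trans (hH.le hsol (Subgroup.mem_sup_right (hP hxH)))
  have hT'M : T' ≤ M := by
    rintro _ ⟨t, ht, rfl⟩
    exact hMn.conj_mem t (hTM ht) g
  have hb : T' = ⊥ := eq_bot_of_p_p' (hHp.to_le hle) (coprime_of_le hT'M hMc)
  exact hT0 ((Subgroup.map_eq_bot_iff_of_injective _ (MulAut.conj g).injective).1 hb)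

end PartE


theorem stmt8 {G : Type*} [Group G] [Finite G] (hG : ¬ IsSolvable G) (x : G)
    (H : Subgroup G) (hH : (H : Set G) = Sol x) :
    ∀ p n : ℕ, p.Prime → Odd p → 0 < n → Nat.card (Sol x) ≠ p ^ n := by
  intro p n hp hodd _ hcard
  have : Fact p.Prime := ⟨hp⟩
  have hp3 : 3 ≤ p := by
    have h2 := hp.two_le
    obtain ⟨k, hk⟩ := hodd
    omega
  have hsub : IsSolSub x H := by
    intro y
    rw [← SetLike.mem_coe, hH]
    exact Iff.rfl
  have hHp : IsPGroup p H := by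
    refine IsPGroup.of_card (n := n) ?_
    rw [← hcard, ← hH]
    rfl
  exact main_aux hp3 (Nat.card G) rfl hG x H hsub hHp
end

section
/- Let G be a finite insoluble group with nontrivial soluble radical R(G), and let x ∈ G. Then |Sol_G(x)| ≠ p³ for every prime p. -/
open Subgroup in
theorem aux_solvable_sup {G : Type*} [Group G] (A B : Subgroup G)
    (h : A ≤ normalizer (B : Set G)) (hA : Group.IsSolvable A) (hB : Group.IsSolvable B) :
    Group.IsSolvable ↥(A ⊔ B) := by
  have e := QuotientGroup.quotientInfEquivProdNormalizerQuotient A B h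
  have hn : (B.subgroupOf (A ⊔ B)).Normal :=
    (normal_subgroupOf_iff_le_normalizer le_sup_right).2 (sup_le h le_normalizer)
  have hn' : (B.subgroupOf A).Normal := normal_subgroupOf_of_le_normalizer h
  rw [Group.isSolvable_iff_subgroup_quotient (B.subgroupOf (A ⊔ B))]
  constructor
  · exact Group.isSolvable_of_isSolvable_injective
      (f := (subgroupOfEquivOfLe (le_sup_right : B ≤ A ⊔ B)).toMonoidHom)
      (subgroupOfEquivOfLe (le_sup_right : B ≤ A ⊔ B)).injective
  · exact Group.isSolvable_of_surjective (f := e.toMonoidHom) e.surjective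

open Subgroup in
theorem aux_mem_Sol {G : Type*} [Group G] {x y : G} (H : Subgroup G) (hH : Group.IsSolvable H)
    (hx : x ∈ H) (hy : y ∈ H) : y ∈ Sol x := by
  have hle : closure {x, y} ≤ H := by
    rw [closure_le]
    rintro z (rfl | rfl) <;> assumption
  exact Group.isSolvable_of_isSolvable_injective (inclusion_injective hle)

open Subgroup in
theorem aux_solvable_comm {G : Type*} [Group G] (P : Subgroup G) [IsMulCommutative P] :
    Group.IsSolvable P :=
  Group.isSolvable_of_comm (fun a b => mul_comm' a b)

/-- if the set `Sol x` is an abelian `p`-subgroup then `G` is solvable. -/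
theorem aux_abelian {G : Type*} [Group G] [Finite G] {p : ℕ} [hp : Fact p.Prime] (x : G)
    (P : Subgroup G) (hPp : IsPGroup p P) [hc : IsMulCommutative P] (hP : Sol x = (P : Set G)) :
    Group.IsSolvable G := by
  have hPs : Group.IsSolvable P := aux_solvable_comm P
  have hxP : x ∈ P := by
    have : x ∈ Sol x := aux_mem_Sol (Subgroup.zpowers x) (aux_solvable_comm _)
      (Subgroup.mem_zpowers x) (Subgroup.mem_zpowers x)
    rwa [hP] at this
  have hN : Subgroup.normalizer (P : Set G) ≤ P := by
    intro g hg
    have : g ∈ Sol x := by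
      refine aux_mem_Sol (Subgroup.zpowers g ⊔ P) (aux_solvable_sup _ _ ?_ (aux_solvable_comm _) hPs)
        (Subgroup.mem_sup_right hxP) (Subgroup.mem_sup_left (Subgroup.mem_zpowers g))
      rwa [Subgroup.zpowers_le]
    rwa [hP] at this
  -- `P` is a Sylow subgroup
  obtain ⟨S, hS⟩ := hPp.exists_le_sylow
  have hSP : (S : Subgroup G) = P := by
    by_contra hne
    have hlt : P < S := lt_of_le_of_ne hS (Ne.symm hne)
    have hnc : NormalizerCondition S := by
      have := S.2.isNilpotent
      exact Group.normalizerCondition_of_isNilpotent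
    have h1 : P.subgroupOf S < ⊤ := by
      rw [lt_top_iff_ne_top, Ne, Subgroup.subgroupOf_eq_top]
      exact not_le_of_gt hlt
    obtain ⟨s, hs, hs'⟩ := SetLike.exists_of_lt (hnc _ h1)
    apply hs'
    rw [Subgroup.mem_subgroupOf]
    apply hN
    rw [Subgroup.mem_normalizer_iff] at hs ⊢
    intro h
    constructor
    · intro hh
      exact (hs ⟨h, hS hh⟩).1 hh
    · intro hh
      have hhS : h ∈ (S : Subgroup G) := by
        have := S.mul_mem (S.mul_mem (S.inv_mem s.2) (hS hh)) s.2
        simpa [mul_assoc] using this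
      exact (hs ⟨h, hhS⟩).2 hh
  have hNC : Subgroup.normalizer (S : Set G) ≤ Subgroup.centralizer (S : Set G) := by
    have hS' : (S : Set G) = (P : Set G) := congrArg (fun H : Subgroup G => (H : Set G)) hSP
    rw [hS']
    exact hN.trans (Subgroup.le_centralizer P)
  set K := (MonoidHom.transferSylow S hNC).ker with hK
  have hcompl : Subgroup.IsComplement' K S := MonoidHom.ker_transferSylow_isComplement' S hNC
  have hpK : ¬ p ∣ Nat.card K := MonoidHom.not_dvd_card_ker_transferSylow S hNC
  have hKbot : K = ⊥ := by
    by_contra hKne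
    have hcard : Nat.card K ≠ 1 := fun h => hKne (Subgroup.card_eq_one.1 h)
    obtain ⟨q, hq, hqK⟩ := Nat.exists_prime_and_dvd hcard
    haveI := Fact.mk hq
    letI act : MulDistribMulAction P K :=
      MulDistribMulAction.compHom K ((MulAut.conjNormal (H := K)).comp P.subtype)
    have hsm : ∀ (g : P) (k : K), ((g • k : K) : G) = (g : G) * k * (g : G)⁻¹ := fun g k => rfl
    have hnd : ¬ p ∣ Nat.card (Sylow q K) := by
      intro h
      obtain ⟨Q⟩ : Nonempty (Sylow q K) := inferInstance
      exact hpK ((h.trans Q.card_dvd_index).trans (Subgroup.index_dvd_card _))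
    obtain ⟨Q, hQ⟩ := hPp.nonempty_fixed_point_of_prime_not_dvd_card (Sylow q K) hnd
    set Q' : Subgroup G := (Q : Subgroup K).map K.subtype with hQ'
    have hPQ : P ≤ Subgroup.normalizer (Q' : Set G) := by
      rw [Subgroup.le_normalizer_iff]
      rintro g hg _ ⟨k, hk, rfl⟩
      have h1 : (⟨g, hg⟩ : P) • k ∈ ((⟨g, hg⟩ : P) • Q : Sylow q K) :=
        Subgroup.smul_mem_pointwise_smul k (⟨g, hg⟩ : P) (Q : Subgroup K) hk
      rw [hQ ⟨g, hg⟩] at h1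
      exact ⟨_, h1, hsm _ _⟩
    have hQs : Group.IsSolvable Q' := by
      have : IsPGroup q Q' := Q.2.map _
      have := this.isNilpotent
      infer_instance
    have hQP : Q' ≤ P := by
      intro g hg
      have : g ∈ Sol x := aux_mem_Sol (P ⊔ Q') (aux_solvable_sup _ _ hPQ hPs hQs)
        (Subgroup.mem_sup_left hxP) (Subgroup.mem_sup_right hg)
      rwa [hP] at this
    have hQK : Q' ≤ K := Subgroup.map_subtype_le _
    have hQbot : Q' = ⊥ := by
      have := hcompl.disjoint
      rw [hSP] at this
      exact le_bot_iff.1 (this hQK hQP)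
    rw [hQ', Subgroup.map_eq_bot_iff_of_injective _ K.subtype_injective] at hQbot
    exact Q.ne_bot_of_dvd_card hqK hQbot
  have htop : P = ⊤ := by
    have := hcompl.sup_eq_top
    rwa [hKbot, hSP, bot_sup_eq] at this
  subst htop
  exact Group.isSolvable_of_surjective (f := (⊤ : Subgroup G).subtype) (fun g => ⟨⟨g, trivial⟩, rfl⟩)

/-- Cardinality of a set that is right invariant under a subgroup. -/
theorem aux_card {G : Type*} [Group G] (X : Subgroup G) (S : Set G)
    (hS : ∀ s ∈ S, ∀ z ∈ X, s * z ∈ S) :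
    QuotientGroup.mk ⁻¹' ((QuotientGroup.mk : G → G ⧸ X) '' S) = S ∧
    Nat.card S = Nat.card X * Nat.card ((QuotientGroup.mk : G → G ⧸ X) '' S) := by
  have h1 : QuotientGroup.mk ⁻¹' ((QuotientGroup.mk : G → G ⧸ X) '' S) = S := by
    ext g
    constructor
    · rintro ⟨s, hs, h⟩
      have := hS s hs _ (QuotientGroup.eq.1 h)
      simpa using this
    · intro h
      exact ⟨g, h, rfl⟩
  refine ⟨h1, ?_⟩
  have := Nat.card_congr
    (QuotientGroup.preimageMkEquivSubgroupProdSet X ((QuotientGroup.mk : G → G ⧸ X) '' S))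
  rw [h1, Nat.card_prod] at this
  exact this

theorem aux_main {G : Type*} [Group G] [Finite G] {p : ℕ} [hp : Fact p.Prime] (x : G)
    (hcard : Nat.card (Sol x) ∣ p ^ 2) : Group.IsSolvable G := by
  set X := Subgroup.zpowers x with hX
  have hXs : Group.IsSolvable X := aux_solvable_comm X
  have hclos : ∀ y ∈ Sol x, ∀ z ∈ Subgroup.closure {x, y}, z ∈ Sol x := by
    intro y hy z hz
    exact aux_mem_Sol _ hy (Subgroup.subset_closure (by simp)) hz
  have hXle : ∀ y, X ≤ Subgroup.closure {x, y} := by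
    intro y
    rw [hX, Subgroup.zpowers_le]
    exact Subgroup.subset_closure (by simp)
  have hycl : ∀ y, y ∈ Subgroup.closure {x, y} := fun y => Subgroup.subset_closure (by simp)
  obtain ⟨hpre, hc⟩ := aux_card X (Sol x)
    (fun s hs z hz => hclos s hs _ (mul_mem (hycl s) (hXle s hz)))
  set T : Set (G ⧸ X) := QuotientGroup.mk '' Sol x with hT
  have hNsub : ∀ g ∈ Subgroup.normalizer (X : Set G), g ∈ Sol x := by
    intro g hg
    refine aux_mem_Sol (Subgroup.zpowers g ⊔ X) (aux_solvable_sup _ _ ?_ (aux_solvable_comm _) hXs)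
      (Subgroup.mem_sup_right (Subgroup.mem_zpowers x))
      (Subgroup.mem_sup_left (Subgroup.mem_zpowers g))
    rwa [Subgroup.zpowers_le]
  have h1 : (1 : G) ∈ Sol x := hNsub 1 (one_mem _)
  obtain ⟨k, hk, hXk⟩ := (Nat.dvd_prime_pow hp.out).1 ((Dvd.intro _ hc.symm).trans hcard)
  have hXp : IsPGroup p X := IsPGroup.of_card hXk
  let M : SubMulAction X (G ⧸ X) :=
    { carrier := T
      smul_mem' := by
        rintro g _ ⟨s, hs, rfl⟩
        exact ⟨g * s, hclos s hs _ (mul_mem (hXle s g.2) (hycl s)), rfl⟩ }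
  have hM : Nat.card M = Nat.card T := rfl
  have hfix := hXp.card_modEq_card_fixedPoints M
  let m1 : M := ⟨QuotientGroup.mk 1, 1, h1, rfl⟩
  have hm1 : m1 ∈ MulAction.fixedPoints X M := by
    intro g
    apply Subtype.ext
    change (QuotientGroup.mk ((g : G) * 1) : G ⧸ X) = QuotientGroup.mk 1
    rw [QuotientGroup.eq]
    simp
  have hall : MulAction.fixedPoints X M = Set.univ := by
    by_cases hx : X = ⊥
    · ext m
      simp only [MulAction.mem_fixedPoints, Set.mem_univ, iff_true]
      rintro ⟨g, hg⟩
      rw [hx, Subgroup.mem_bot] at hg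
      subst hg
      exact one_smul X m
    · have hk0 : k ≠ 0 := by
        rintro rfl
        rw [pow_zero] at hXk
        exact hx (Subgroup.card_eq_one.1 hXk)
      have hTp : Nat.card M ∣ p := by
        rw [hc, hXk] at hcard
        have : p * Nat.card M ∣ p * p := by
          rw [← sq, hM]
          exact (mul_dvd_mul_right (dvd_pow_self p hk0) _).trans hcard
        exact Nat.dvd_of_mul_dvd_mul_left hp.out.pos this
      have hpos : 0 < Nat.card (MulAction.fixedPoints X M) :=
        Nat.card_pos_iff.2 ⟨⟨⟨m1, hm1⟩⟩, inferInstance⟩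
      apply Set.eq_of_subset_of_ncard_le (Set.subset_univ _) _ Set.finite_univ
      rw [Set.ncard_univ]
      change Nat.card M ≤ Nat.card (MulAction.fixedPoints X M)
      rcases (Nat.dvd_prime hp.out).1 hTp with h | h
      · omega
      · rw [h] at hfix ⊢
        exact Nat.le_of_dvd hpos ((Nat.modEq_iff_dvd' (Nat.zero_le _)).1
          ((Nat.modEq_zero_iff_dvd.2 dvd_rfl).symm.trans hfix))
  have hSN : Sol x = (Subgroup.normalizer (X : Set G) : Set G) := by
    apply Set.Subset.antisymm _ hNsub
    intro y hy
    rw [SetLike.mem_coe, ← Sylow.mem_fixedPoints_mul_left_cosets_iff_mem_normalizer]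
    intro g
    have : (⟨QuotientGroup.mk y, y, hy, rfl⟩ : M) ∈ MulAction.fixedPoints X M := by
      rw [hall]; trivial
    exact congrArg Subtype.val (this g)
  have hcN : Nat.card (Subgroup.normalizer (X : Set G)) ∣ p ^ 2 := by
    have : Nat.card (Sol x) = Nat.card (Subgroup.normalizer (X : Set G)) := by
      rw [hSN]; rfl
    rwa [← this]
  obtain ⟨j, hj, hNj⟩ := (Nat.dvd_prime_pow hp.out).1 hcN
  have hcomm : IsMulCommutative (Subgroup.normalizer (X : Set G)) := by
    interval_cases j
    · have : Subsingleton (Subgroup.normalizer (X : Set G)) :=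
        (Nat.card_eq_one_iff_unique.1 (by simpa using hNj)).1
      exact ⟨⟨fun a b => Subsingleton.elim _ _⟩⟩
    · have := isCyclic_of_prime_card (p := p) (by simpa using hNj)
      infer_instance
    · exact IsPGroup.isMulCommutative_of_card_eq_prime_sq hNj
  exact aux_abelian (p := p) x _ (IsPGroup.of_card hNj) hSN

theorem aux_Sol_quotient {G : Type*} [Group G] (R : Subgroup G) [R.Normal]
    (hRs : Group.IsSolvable R) (x : G) :
    Sol x = QuotientGroup.mk ⁻¹' (Sol (x : G ⧸ R)) := by
  ext y
  have hmap : (Subgroup.closure {x, y}).map (QuotientGroup.mk' R) =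
      Subgroup.closure {(x : G ⧸ R), (y : G ⧸ R)} := by
    rw [MonoidHom.map_closure, Set.image_pair]; rfl
  constructor
  · intro h
    have h' : Group.IsSolvable (Subgroup.closure {x, y}) := h
    change Group.IsSolvable (Subgroup.closure {(x : G ⧸ R), (y : G ⧸ R)})
    rw [← hmap]
    exact Group.isSolvable_of_surjective
      (MonoidHom.subgroupMap_surjective (QuotientGroup.mk' R) (Subgroup.closure {x, y}))
  · intro h
    have h' : Group.IsSolvable (Subgroup.closure {(x : G ⧸ R), (y : G ⧸ R)}) := h
    rw [← hmap] at h'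
    refine aux_mem_Sol (Subgroup.closure {x, y} ⊔ R) ?_
      (Subgroup.mem_sup_left (Subgroup.subset_closure (by simp)))
      (Subgroup.mem_sup_left (Subgroup.subset_closure (by simp)))
    have hle : (Subgroup.closure {x, y} ⊔ R) ≤
        ((Subgroup.closure {x, y}).map (QuotientGroup.mk' R)).comap (QuotientGroup.mk' R) := by
      rw [Subgroup.comap_map_eq, QuotientGroup.ker_mk']
    let g : ↥(Subgroup.closure {x, y} ⊔ R) →*
        ↥((Subgroup.closure {x, y}).map (QuotientGroup.mk' R)) :=
      ((QuotientGroup.mk' R).comp (Subgroup.subtype _)).codRestrict _ (fun a => hle a.2)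
    refine Group.isSolvable_of_ker_le_range
      (Subgroup.inclusion (le_sup_right : R ≤ Subgroup.closure {x, y} ⊔ R)) g ?_
    intro a ha
    have ha' : (QuotientGroup.mk' R) (a : G) = 1 := congrArg Subtype.val (MonoidHom.mem_ker.1 ha)
    have haR : (a : G) ∈ R := (QuotientGroup.eq_one_iff _).1 ha'
    exact ⟨⟨a, haR⟩, rfl⟩

theorem stmt11 {G : Type*} [Group G] [Finite G] (hG : ¬ IsSolvable G)
    (R : Subgroup G) (hRn : R.Normal) (hRs : IsSolvable R)
    (hRmax : ∀ N : Subgroup G, N.Normal → IsSolvable N → N ≤ R)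
    (hR : R ≠ ⊥) (x : G) :
    ∀ p : ℕ, p.Prime → Nat.card (Sol x) ≠ p ^ 3 := by
  intro p hp hc
  haveI := Fact.mk hp
  have hRs' : Group.IsSolvable R := hRs
  apply hG
  have hcard : Nat.card (Sol x) = Nat.card R * Nat.card (Sol (x : G ⧸ R)) := by
    rw [aux_Sol_quotient R hRs' x,
      Nat.card_congr (QuotientGroup.preimageMkEquivSubgroupProdSet R _), Nat.card_prod]
  rw [hc] at hcard
  obtain ⟨k, hk, hRk⟩ := (Nat.dvd_prime_pow hp).1 (Dvd.intro _ hcard.symm)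
  have hk0 : k ≠ 0 := by
    rintro rfl
    rw [pow_zero] at hRk
    exact hR (Subgroup.card_eq_one.1 hRk)
  have hd : Nat.card (Sol (x : G ⧸ R)) ∣ p ^ 2 := by
    have : p * Nat.card (Sol (x : G ⧸ R)) ∣ p * p ^ 2 := by
      rw [← pow_succ', hcard, hRk]
      exact mul_dvd_mul_right (dvd_pow_self p hk0) _
    exact Nat.dvd_of_mul_dvd_mul_left hp.pos this
  exact (Group.isSolvable_iff_subgroup_quotient R).2 ⟨hRs', aux_main (p := p) (x : G ⧸ R) hd⟩
end

section
/- Let G be a finite insoluble group. Then |Sol_G(x)| ≠ 8 for every element x ∈ G. -/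
open Subgroup
namespace Sol8

theorem sup_solvable {G : Type*} [Group G] {H N : Subgroup G} (hLE : H ≤ normalizer (N : Set G))
    (hH : Group.IsSolvable H) (hN : Group.IsSolvable N) : Group.IsSolvable (H ⊔ N : Subgroup G) := by
  have := Subgroup.normal_subgroupOf_of_le_normalizer hLE
  have := Subgroup.normal_subgroupOf_sup_of_le_normalizer hLE
  rw [Group.isSolvable_iff_subgroup_quotient (N.subgroupOf (H ⊔ N))]
  constructor
  · exact Group.isSolvable_of_isSolvable_injective
      (f := (Subgroup.subgroupOfEquivOfLe (le_sup_right : N ≤ H ⊔ N)).toMonoidHom)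
      (MulEquiv.injective _)
  · exact Group.isSolvable_of_surjective
      (f := (QuotientGroup.quotientInfEquivProdNormalizerQuotient H N hLE).toMonoidHom)
      (MulEquiv.surjective _)

theorem solvable_of_le {G : Type*} [Group G] {H K : Subgroup G} (h : H ≤ K)
    (hK : Group.IsSolvable K) : Group.IsSolvable H :=
  Group.isSolvable_of_isSolvable_injective (f := Subgroup.inclusion h) (Subgroup.inclusion_injective h)

theorem zpowers_solvable {G : Type*} [Group G] (y : G) : Group.IsSolvable (zpowers y) :=
  Group.isSolvable_of_comm fun a b => by
    obtain ⟨_, m, rfl⟩ := a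
    obtain ⟨_, n, rfl⟩ := b
    exact Subtype.ext (zpow_mul_comm y m n)

theorem pgroup_solvable {G : Type*} [Group G] [Finite G] {p : ℕ} [Fact p.Prime] (h : IsPGroup p G) :
    Group.IsSolvable G := by
  have := h.isNilpotent
  infer_instance

theorem sol_of_le {G : Type*} [Group G] {x y : G} {H : Subgroup G} (hH : Group.IsSolvable H)
    (hx : x ∈ H) (hy : y ∈ H) : y ∈ Sol x := by
  refine solvable_of_le (K := H) ?_ hH
  rw [closure_le]
  rintro a (rfl | rfl) <;> assumption

theorem sol_of_normalizer {G : Type*} [Group G] {x y : G} {H : Subgroup G} (hH : Group.IsSolvable H)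
    (hx : x ∈ H) (hy : y ∈ normalizer (H : Set G)) : y ∈ Sol x := by
  have : zpowers y ≤ normalizer (H : Set G) := by simpa using hy
  exact sol_of_le (sup_solvable this (zpowers_solvable y) hH) (mem_sup_right hx)
    (mem_sup_left (mem_zpowers y))

theorem sol_of_invol {G : Type*} [Group G] {x y : G} (hx : x * x = 1) (hy : y * y = 1) :
    y ∈ Sol x := by
  have hxinv : x⁻¹ = x := inv_eq_of_mul_eq_one_left hx
  have hyinv : y⁻¹ = y := inv_eq_of_mul_eq_one_left hy
  have : zpowers x ≤ normalizer (zpowers (x * y) : Set G) := by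
    rw [zpowers_le]
    have key : ∀ n : G, n ∈ zpowers (x * y) → x * n * x⁻¹ ∈ zpowers (x * y) := by
      rintro _ ⟨k, rfl⟩
      refine ⟨-k, ?_⟩
      simp only
      rw [← conj_zpow, zpow_neg, ← inv_zpow]
      congr 1
      rw [mul_inv_rev, hxinv, hyinv, ← mul_assoc, hx, one_mul]
    intro n
    refine ⟨key n, fun h => ?_⟩
    have := key _ h
    rw [hxinv] at this
    have e : x * (x * n * x) * x = n := by
      calc _ = (x * x) * n * (x * x) := by group
        _ = n := by rw [hx]; simp
    rwa [e] at this
  refine sol_of_le (sup_solvable this (zpowers_solvable x) (zpowers_solvable (x * y)))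
    (mem_sup_left (mem_zpowers x)) ?_
  have e : x⁻¹ * (x * y) = y := by group
  have h := mul_mem (inv_mem (mem_sup_left (T := zpowers (x * y)) (mem_zpowers x)))
    (mem_sup_right (mem_zpowers (x * y)))
  rwa [e] at h

theorem sol_card_le {G : Type*} [Group G] [Finite G] {x : G} (h8 : Nat.card (Sol x) = 8)
    {H : Subgroup G} (hH : Group.IsSolvable H) (hx : x ∈ H) : Nat.card H ≤ 8 := by
  rw [← h8]
  exact Nat.card_mono (Set.toFinite _) (fun y hy => sol_of_le hH hx hy)

theorem orderOf_dvd_sol {G : Type*} [Group G] [Finite G] (x : G) :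
    orderOf x ∣ Nat.card (Sol x) := by
  have key : ∀ y k, k ∈ zpowers x → y ∈ Sol x → y * k ∈ Sol x := by
    intro y k hk hy
    refine sol_of_le (H := closure {x, y}) hy (subset_closure (by simp)) ?_
    refine mul_mem (subset_closure (by simp)) ?_
    have : zpowers x ≤ closure {x, y} := by
      rw [zpowers_le]; exact subset_closure (by simp)
    exact this hk
  have e : Sol x = Set.preimage (QuotientGroup.mk : G → G ⧸ zpowers x)
      (Set.image QuotientGroup.mk (Sol x)) := by
    ext y
    constructor
    · intro h; exact ⟨y, h, rfl⟩
    · rintro ⟨w, hw, e⟩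
      rw [QuotientGroup.eq] at e
      have := key w _ e hw
      simpa using this
  rw [e, QuotientGroup.card_preimage_mk, Nat.card_zpowers]
  exact Dvd.intro _ rfl

/-- odd normal complement -/
theorem solvable_of_complement {G : Type*} [Group G] [Finite G] (P : Sylow 2 G)
    (hP : ∀ H : Subgroup G, Group.IsSolvable H → (P : Subgroup G) ≤ H → Nat.card H < 5 * Nat.card P)
    (K : Subgroup G) [K.Normal] (hK : ¬ 2 ∣ Nat.card K) (hKP : IsPGroup 2 (G ⧸ K)) :
    Group.IsSolvable G := by
  have hZ : IsZGroup K := by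
    constructor
    intro q hq Q0
    have : Fact q.Prime := ⟨hq⟩
    let : MulDistribMulAction P K := MulDistribMulAction.compHom K
      ((MulAut.conjNormal (H := K)).comp (P : Subgroup G).subtype)
    have hnd : ¬ 2 ∣ Nat.card (Sylow q K) := fun h =>
      hK (h.trans (Q0.card_dvd_index.trans (Subgroup.index_dvd_card _)))
    obtain ⟨Q, hQ⟩ := P.2.nonempty_fixed_point_of_prime_not_dvd_card (Sylow q K) hnd
    have hQcard : Nat.card Q0 = Nat.card Q := Nat.card_congr (Q0.equiv Q).toEquiv
    let R : Subgroup G := (Q : Subgroup K).map K.subtype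
    have hRcard : Nat.card R = Nat.card Q := 
      (Nat.card_congr (equivMapOfInjective (Q : Subgroup K) _ K.subtype_injective).toEquiv).symm
    have hinv : ∀ p ∈ P, ∀ n ∈ R, p * n * p⁻¹ ∈ R := by
      rintro p hp _ ⟨n, hn, rfl⟩
      have h1 := hQ ⟨p, hp⟩
      have h2 : (⟨p, hp⟩ : P) • n ∈ (⟨p, hp⟩ : P) • Q := Subgroup.smul_mem_pointwise_smul n _ _ hn
      rw [h1] at h2
      exact ⟨_, h2, rfl⟩
    have hPR : (P : Subgroup G) ≤ normalizer (R : Set G) := by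
      intro p hp n
      refine ⟨hinv p hp n, fun h => ?_⟩
      have := hinv p⁻¹ (inv_mem hp) _ h
      simpa [mul_assoc] using this
    have hRs : Group.IsSolvable R := by
      have : IsPGroup q R := Q.2.map _
      exact pgroup_solvable this
    have hlt := hP _ (sup_solvable hPR (pgroup_solvable P.2) hRs) le_sup_left
    have hRK : Nat.card R ∣ Nat.card K := card_dvd_of_le (by
      rintro _ ⟨n, hn, rfl⟩; exact n.2)
    have h2R : ¬ 2 ∣ Nat.card R := fun h => hK (h.trans hRK)
    have hcop : Nat.Coprime (Nat.card P) (Nat.card R) := by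
      obtain ⟨n, hn⟩ := P.2.exists_card_eq
      rw [hn]
      exact Nat.Coprime.pow_left _ ((Nat.prime_two.coprime_iff_not_dvd).2 h2R)
    have hdvd : Nat.card P * Nat.card R ∣ Nat.card ((P : Subgroup G) ⊔ R : Subgroup G) :=
      hcop.mul_dvd_of_dvd_of_dvd (card_dvd_of_le le_sup_left) (card_dvd_of_le le_sup_right)
    have hle := Nat.le_of_dvd Nat.card_pos hdvd
    have h5 : Nat.card R < 5 := by
      have : Nat.card P * Nat.card R < Nat.card P * 5 := by omega
      exact lt_of_mul_lt_mul_left this (Nat.zero_le _)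
    have hpos : 0 < Nat.card R := Nat.card_pos
    have h13 : Nat.card R = 1 ∨ Nat.card R = 3 := by omega
    apply isCyclic_of_card_dvd_prime (p := 3)
    rw [hQcard, ← hRcard]
    rcases h13 with h | h <;> rw [h] <;> norm_num
  rw [Group.isSolvable_iff_subgroup_quotient K]
  exact ⟨inferInstance, pgroup_solvable hKP⟩

theorem solvable_of_burnside {G : Type*} [Group G] [Finite G] (P : Sylow 2 G)
    (hP : ∀ H : Subgroup G, Group.IsSolvable H → (P : Subgroup G) ≤ H → Nat.card H < 5 * Nat.card P)
    (hN : normalizer (P : Set G) ≤ centralizer (P : Set G)) :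
    Group.IsSolvable G := by
  refine solvable_of_complement P hP (MonoidHom.transferSylow P hN).ker
    (MonoidHom.not_dvd_card_ker_transferSylow P hN) ?_
  refine P.2.of_injective (QuotientGroup.kerLift (MonoidHom.transferSylow P hN)) 
    (QuotientGroup.kerLift_injective _)

theorem solvable_of_abelian {G : Type*} [Group G] [Finite G] (P : Sylow 2 G)
    (hP : ∀ H : Subgroup G, Group.IsSolvable H → (P : Subgroup G) ≤ H → H ≤ P)
    (hc : ∀ a ∈ P, ∀ b ∈ P, a * b = b * a) :
    Group.IsSolvable G := by
  refine solvable_of_burnside P (fun H h1 h2 => ?_) ?_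
  · rw [le_antisymm (hP H h1 h2) h2]
    have : 0 < Nat.card P := Nat.card_pos
    change Nat.card P < _
    omega
  · intro y hy
    have h1 : zpowers y ≤ normalizer ((P : Subgroup G) : Set G) := by
      rw [zpowers_le]; exact hy
    have h2 := hP _ (sup_solvable h1 (zpowers_solvable y) (pgroup_solvable P.2)) le_sup_right
    have h3 : y ∈ P := h2 (mem_sup_left (mem_zpowers y))
    intro p hp
    exact hc _ hp _ h3


theorem struct8 {P : Type*} [Group P] (h8 : Nat.card P = 8) (hnc : ¬ ∀ a b : P, a * b = b * a)
    (x : P) (hx : x * x ≠ 1) : x ^ 4 = 1 ∧ (∀ p, p * x ^ 2 = x ^ 2 * p) ∧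
      (∃ p, p * x * p⁻¹ = x⁻¹) ∧ commutator P ≤ zpowers (x ^ 2) := by
  have hfin : Finite P := Nat.finite_of_card_ne_zero (by rw [h8]; norm_num)
  have ho : orderOf x = 4 := by
    have h1 : orderOf x ∣ 2 ^ 3 := by
      have := orderOf_dvd_natCard x
      rw [h8] at this; exact this
    obtain ⟨k, hk, hk2⟩ := (Nat.dvd_prime_pow Nat.prime_two).1 h1
    have hx2 : ¬ orderOf x ∣ 2 := fun h => hx (by
      rw [← pow_two]; exact orderOf_dvd_iff_pow_eq_one.1 h)
    interval_cases k
    · exact absurd (by rw [hk2]; norm_num) hx2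
    · exact absurd (by rw [hk2]; norm_num) hx2
    · exact hk2
    · exfalso
      apply hnc
      have : IsCyclic P := isCyclic_of_orderOf_eq_card x (by rw [hk2, h8]; norm_num)
      intro a b
      exact (IsCyclic.isMulCommutative (α := P)).is_comm.comm a b
  have hx4 : x ^ 4 = 1 := by rw [← ho]; exact pow_orderOf_eq_one x
  have hzc : Nat.card (zpowers x) = 4 := by rw [Nat.card_zpowers, ho]
  have hidx : (zpowers x).index = 2 := by
    have := (zpowers x).card_mul_index
    rw [hzc, h8] at this; omega
  have hnorm := normal_of_index_eq_two hidx
  have hconj : ∀ p, p * x * p⁻¹ = x ∨ p * x * p⁻¹ = x⁻¹ := by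
    intro p
    have h1 : p * x * p⁻¹ ∈ zpowers x := hnorm.conj_mem x (mem_zpowers x) p
    classical
    rw [mem_zpowers_iff_mem_range_orderOf, ho] at h1
    simp only [Finset.mem_image, Finset.mem_range] at h1
    obtain ⟨k, hk, e⟩ := h1
    have hsq : (p * x * p⁻¹) ^ 2 ≠ 1 := by
      rw [conj_pow]
      intro h
      apply hx
      rw [← pow_two]
      simpa using h
    interval_cases k
    · rw [← e] at hsq; simp at hsq
    · left; rw [← e, pow_one]
    · rw [← e, ← pow_mul] at hsq; exact absurd hx4 hsq
    · right; rw [← e]; exact eq_inv_of_mul_eq_one_left (by rw [← pow_succ]; exact hx4)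
  have hcen : ∀ p, p * x ^ 2 = x ^ 2 * p := by
    intro p
    have : p * x ^ 2 * p⁻¹ = x ^ 2 := by
      rw [← conj_pow]
      rcases hconj p with h | h
      · rw [h]
      · rw [h, inv_pow]; exact inv_eq_of_mul_eq_one_left (by rw [← pow_add]; exact hx4)
    exact mul_inv_eq_iff_eq_mul.1 this
  refine ⟨hx4, hcen, ?_, ?_⟩
  · by_contra hcon
    push Not at hcon
    have hxc : x ∈ center P := by
      rw [mem_center_iff]
      intro p
      exact mul_inv_eq_iff_eq_mul.1 ((hconj p).resolve_right (hcon p))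
    have hle : zpowers x ≤ center P := by rw [zpowers_le]; exact hxc
    have hd : (center P).index ∣ 2 := by
      rw [← hidx]; exact index_dvd_of_le hle
    have : IsCyclic (P ⧸ center P) := isCyclic_of_card_dvd_prime (p := 2) hd
    apply hnc
    exact (isMulCommutative_of_isCyclic_quotient_center_self P).is_comm.comm
  · have hn2 : (zpowers (x ^ 2)).Normal := by
      constructor
      rintro n hn g
      obtain ⟨k, rfl⟩ := hn
      have : Commute g (x ^ 2) := hcen g
      have h2 : g * (x ^ 2) ^ k * g⁻¹ = (x ^ 2) ^ k := by
        rw [(this.zpow_right k).eq]; group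
      exact ⟨k, h2.symm⟩
    have hc2 : Nat.card (zpowers (x ^ 2)) = 2 := by
      rw [Nat.card_zpowers, orderOf_pow, ho]; norm_num
    have hq : Nat.card (P ⧸ zpowers (x ^ 2)) = 2 ^ 2 := by
      have := (zpowers (x ^ 2)).card_mul_index
      rw [hc2, h8] at this
      change (zpowers (x ^ 2)).index = _
      omega
    rw [← Subgroup.Normal.quotient_commutative_iff_commutator_le]
    exact IsPGroup.isMulCommutative_of_card_eq_prime_sq hq

section eight
variable {G : Type*} [Group G] [Finite G] (P : Sylow 2 G) (x : G)

/-- the centralizer of `x ^ 2` lies in `P` -/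
theorem centralizer_le (h8 : Nat.card P = 8) (hx : x ∈ P)
    (hS : ∀ H : Subgroup G, Group.IsSolvable H → x ∈ H → H ≤ P)
    (hz : x ^ 2 ≠ 1) (hx4 : x ^ 4 = 1) (hcen : ∀ p ∈ P, p * x ^ 2 = x ^ 2 * p) :
    ∀ y, y * x ^ 2 = x ^ 2 * y → y ∈ P := by
  let C : Subgroup G := centralizer {x ^ 2}
  have hPC : (P : Subgroup G) ≤ C := by
    intro p hp
    rw [mem_centralizer_singleton_iff]
    exact (hcen p hp)
  suffices hC : Group.IsSolvable C by
    intro y hy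
    refine hS C hC (hPC hx) ?_
    rw [mem_centralizer_singleton_iff]
    exact hy
  let z : C := ⟨x ^ 2, hPC (pow_mem hx 2)⟩
  let Z : Subgroup C := zpowers z
  have hzc : ∀ g : C, Commute g z := by
    intro g
    have := g.2
    rw [mem_centralizer_singleton_iff] at this
    exact Subtype.ext this
  have hZn : Z.Normal := by
    constructor
    rintro n hn g
    obtain ⟨k, rfl⟩ := hn
    have h2 : g * z ^ k * g⁻¹ = z ^ k := by
      rw [((hzc g).zpow_right k).eq]; group
    exact ⟨k, h2.symm⟩
  have hZ2 : Nat.card Z = 2 := by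
    rw [Nat.card_zpowers]
    refine orderOf_eq_prime (Subtype.ext ?_) (fun h => hz (congrArg Subtype.val h))
    change (x ^ 2) ^ 2 = 1
    rw [← pow_mul]; exact hx4
  have hZs : Group.IsSolvable Z := zpowers_solvable z
  rw [Group.isSolvable_iff_subgroup_quotient Z]
  refine ⟨hZs, ?_⟩
  let f := QuotientGroup.mk' Z
  have hf : Function.Surjective f := QuotientGroup.mk'_surjective Z
  let PC : Sylow 2 C := P.subtype hPC
  let Pb : Sylow 2 (C ⧸ Z) := PC.mapSurjective hf
  have hPb : (Pb : Subgroup (C ⧸ Z)) = (PC : Subgroup C).map f := rfl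
  have hPCc : Nat.card PC = 8 := by
    rw [← h8]
    exact Nat.card_congr (subgroupOfEquivOfLe hPC).toEquiv
  have hZP : Z ≤ PC := by
    rw [zpowers_le]
    exact pow_mem hx 2
  refine solvable_of_abelian Pb ?_ ?_
  · intro H hH hle
    have h1 : Group.IsSolvable (H.comap f) := by
      refine Group.isSolvable_of_ker_le_range (Subgroup.inclusion (H := Z) (K := H.comap f) ?_)
        ((f.comp (H.comap f).subtype).codRestrict H (fun y => y.2)) ?_
      · intro y hy
        have : f y = 1 := (QuotientGroup.eq_one_iff y).2 hy
        rw [mem_comap, this]; exact one_mem _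
      · intro y hy
        have h2 : f y = 1 := congrArg Subtype.val hy
        exact ⟨⟨y, (QuotientGroup.eq_one_iff _).1 h2⟩, rfl⟩
    have h2 : Group.IsSolvable ((H.comap f).map C.subtype) :=
      Group.isSolvable_of_surjective (f := (C.subtype).subgroupMap (H.comap f))
        (MonoidHom.subgroupMap_surjective _ _)
    have h3 : (PC : Subgroup C) ≤ H.comap f := by
      rw [← map_le_iff_le_comap]; exact hle
    have h4 := hS _ h2 ⟨⟨x, hPC hx⟩, h3 hx, rfl⟩
    rw [hPb]
    intro y hy
    obtain ⟨w, rfl⟩ := hf y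
    exact ⟨w, h4 ⟨w, hy, rfl⟩, rfl⟩
  · have hc : Nat.card Pb = 2 ^ 2 := by
      have e1 : (Z.subgroupOf PC).index * Nat.card (Z.subgroupOf PC) = Nat.card PC := 
        (Z.subgroupOf PC).index_mul_card
      have e2 : Nat.card (Z.subgroupOf PC) = 2 := by
        exact (Nat.card_congr (subgroupOfEquivOfLe hZP).toEquiv).trans hZ2
      have e3 : Nat.card ((PC : Subgroup C).map f) = (Z.subgroupOf PC).index := by
        have : (f.comp (PC : Subgroup C).subtype).ker = Z.subgroupOf PC := by
          ext y
          rw [MonoidHom.mem_ker, mem_subgroupOf]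
          exact QuotientGroup.eq_one_iff _
        rw [← this, index_ker, MonoidHom.range_comp, range_subtype]
      change Nat.card ((PC : Subgroup C).map f) = _
      rw [e3]
      rw [e2, hPCc] at e1
      omega
    have := (IsPGroup.isMulCommutative_of_card_eq_prime_sq hc).is_comm.comm
    intro a ha b hb
    exact congrArg Subtype.val (this ⟨a, ha⟩ ⟨b, hb⟩)


theorem normalizer_le_self (hx : x ∈ P)
    (hS : ∀ H : Subgroup G, Group.IsSolvable H → x ∈ H → H ≤ P) (g : G)
    (hg : ∀ n, n ∈ P ↔ g * n * g⁻¹ ∈ P) : g ∈ P := by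
  have h1 : zpowers g ≤ normalizer ((P : Subgroup G) : Set G) := by
    rw [zpowers_le]; exact hg
  exact hS _ (sup_solvable h1 (zpowers_solvable g) (pgroup_solvable P.2)) (mem_sup_right hx)
    (mem_sup_left (mem_zpowers g))

theorem mem_of_conj_le (hx : x ∈ P)
    (hS : ∀ H : Subgroup G, Group.IsSolvable H → x ∈ H → H ≤ P) (g : G)
    (hg : ∀ n ∈ P, g * n * g⁻¹ ∈ P) : g ∈ P := by
  refine normalizer_le_self P x hx hS g fun n => ⟨hg n, fun h => ?_⟩
  let R : Subgroup G := (P : Subgroup G).map (MulAut.conj g).toMonoidHom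
  have hle : R ≤ P := by
    rintro _ ⟨n, hn, rfl⟩
    exact hg n hn
  have hc : Nat.card R = Nat.card P :=
    (Nat.card_congr (equivMapOfInjective (P : Subgroup G) _ (MulAut.conj g).injective).toEquiv).symm
  have he : R = P := eq_of_le_of_card_ge hle hc.ge
  have h2 : g * n * g⁻¹ ∈ R := by rw [he]; exact h
  obtain ⟨m, hm, e⟩ := h2
  have ecoe : g * m * g⁻¹ = g * n * g⁻¹ := e
  have : m = n := by simpa using ecoe
  rwa [← this]

theorem mem_of_conj_x (hx : x ∈ P)
    (hS : ∀ H : Subgroup G, Group.IsSolvable H → x ∈ H → H ≤ P) (g : G)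
    (hg : g⁻¹ * x * g ∈ P) : g ∈ P := by
  let R : Subgroup G := (P : Subgroup G).map (MulAut.conj g).toMonoidHom
  have hR : Group.IsSolvable R := pgroup_solvable (P.2.map _)
  have hle := hS R hR ⟨_, hg, by simp [mul_assoc]⟩
  exact mem_of_conj_le P x hx hS g fun n hn => hle ⟨n, hn, rfl⟩

theorem le_normalizer_of_card {V R : Subgroup G} (hV : Nat.card V = 4) (hR : Nat.card R = 8)
    (h : V ≤ R) : R ≤ normalizer (V : Set G) := by
  rw [← normal_subgroupOf_iff_le_normalizer h]
  apply normal_of_index_eq_two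
  have h1 := (V.subgroupOf R).index_mul_card
  have h2 : Nat.card (V.subgroupOf R) = 4 :=
    (Nat.card_congr (subgroupOfEquivOfLe h).toEquiv).trans hV
  rw [h2, hR] at h1
  omega

theorem perm_solvable {X : Type*} [Finite X] (h : Nat.card X ≤ 3) :
    Group.IsSolvable (Equiv.Perm X) := by
  have : IsZGroup (Equiv.Perm X) := by
    apply IsZGroup.of_squarefree
    rw [Nat.card_perm]
    have h6 : Squarefree 6 := by
      rw [show 6 = 2 * 3 from rfl, Nat.squarefree_mul (by norm_num)]
      exact ⟨Nat.prime_two.squarefree, Nat.prime_three.squarefree⟩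
    exact h6.squarefree_of_dvd (Nat.factorial_dvd_factorial h)
  infer_instance

theorem no_fusion (h8 : Nat.card P = 8) (hx : x ∈ P)
    (hS : ∀ H : Subgroup G, Group.IsSolvable H → x ∈ H → H ≤ P)
    (hz : x ^ 2 ≠ 1) (hcen : ∀ p ∈ P, p * x ^ 2 = x ^ 2 * p)
    (hC : ∀ y, y * x ^ 2 = x ^ 2 * y → y ∈ P) (g : G) (hg : g⁻¹ * x ^ 2 * g ∈ P) :
    g⁻¹ * x ^ 2 * g = x ^ 2 := by
  by_contra hne
  have hgP : g ∉ P := by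
    intro h
    apply hne
    have := hcen g h
    rw [mul_assoc, ← this]; simp
  let R : Subgroup G := (P : Subgroup G).map (MulAut.conj g⁻¹).toMonoidHom
  have hR8 : Nat.card R = 8 :=
    (Nat.card_congr (equivMapOfInjective (P : Subgroup G) _
      (MulAut.conj g⁻¹).injective).toEquiv).symm.trans h8
  have memR : ∀ y, g * y * g⁻¹ ∈ P → y ∈ R := fun y hy => ⟨_, hy, by simp [mul_assoc]⟩
  have hnle : ¬ R ≤ P := by
    intro hle
    apply hgP
    rw [← inv_mem_iff]
    exact mem_of_conj_le P x hx hS g⁻¹ fun n hn => hle ⟨n, hn, rfl⟩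
  have hzP : x ^ 2 ∈ P := pow_mem hx 2
  let V : Subgroup G := (P : Subgroup G) ⊓ R
  have hzV : x ^ 2 ∈ V := by
    refine ⟨hzP, memR _ (hC _ ?_)⟩
    have h1 := hcen _ hg
    calc g * x ^ 2 * g⁻¹ * x ^ 2 = g * (x ^ 2 * (g⁻¹ * x ^ 2 * g)) * g⁻¹ := by
          simp only [mul_assoc, mul_inv_cancel, mul_one]
      _ = g * ((g⁻¹ * x ^ 2 * g) * x ^ 2) * g⁻¹ := by rw [h1]
      _ = _ := by simp only [mul_assoc, mul_inv_cancel_left]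
  have haV : g⁻¹ * x ^ 2 * g ∈ V := by
    refine ⟨hg, memR _ ?_⟩
    have : g * (g⁻¹ * x ^ 2 * g) * g⁻¹ = x ^ 2 := by simp [mul_assoc]
    rw [this]; exact hzP
  have ha1 : g⁻¹ * x ^ 2 * g ≠ 1 := by
    intro h
    apply hz
    have : x ^ 2 = g * (g⁻¹ * x ^ 2 * g) * g⁻¹ := by simp [mul_assoc]
    rw [this, h]; simp
  have hV4 : Nat.card V = 4 := by
    have hd : Nat.card V ∣ 2 ^ 3 := by
      have := card_dvd_of_le (inf_le_left : V ≤ P)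
      rw [h8] at this
      exact this
    have h3 : 2 < Nat.card V := by
      have : ({1, x ^ 2, g⁻¹ * x ^ 2 * g} : Set G) ⊆ V := by
        rintro a (rfl | rfl | rfl)
        · exact one_mem V
        · exact hzV
        · exact haV
      have h5 := Set.ncard_le_ncard this (Set.toFinite _)
      rw [Set.ncard_eq_three.2 ⟨1, x ^ 2, _, hz.symm, ha1.symm, Ne.symm hne, rfl⟩] at h5
      exact h5
    have hne8 : Nat.card V ≠ 8 := by
      intro h
      apply hnle
      have e : V = R := eq_of_le_of_card_ge inf_le_right (by rw [h, hR8])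
      rw [← e]; exact inf_le_left
    obtain ⟨k, hk, hk2⟩ := (Nat.dvd_prime_pow Nat.prime_two).1 hd
    interval_cases k <;> omega
  let H : Subgroup G := normalizer (V : Set G)
  have hPH : (P : Subgroup G) ≤ H := le_normalizer_of_card hV4 h8 inf_le_left
  have hRH : R ≤ H := le_normalizer_of_card hV4 hR8 inf_le_right
  suffices hH : Group.IsSolvable H from hnle (hRH.trans (hS H hH (hPH hx)))
  let PsubH : Subgroup H := (P : Subgroup G).subgroupOf H
  have hcard : Nat.card (H ⧸ PsubH) ≤ 3 := by
    have hS3 : Nat.card ((V : Set G) \ {1} : Set G) = 3 := by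
      have h1 := Set.ncard_sdiff_singleton_of_mem (one_mem V : (1 : G) ∈ (V : Set G))
      have h2 : (V : Set G).ncard = 4 := hV4
      rw [h2] at h1
      exact h1
    rw [← hS3]
    refine Nat.card_le_card_of_injective
      (fun q => ⟨(q.out : G) * x ^ 2 * (q.out : G)⁻¹, ⟨(q.out.2 (x ^ 2)).1 hzV, ?_⟩⟩) ?_
    · intro h
      apply hz
      have hcoe : (q.out : G) * x ^ 2 * (q.out : G)⁻¹ = 1 := h
      simpa using hcoe
    · intro q r e
      have ecoe : (q.out : G) * x ^ 2 * (q.out : G)⁻¹ = (r.out : G) * x ^ 2 * (r.out : G)⁻¹ :=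
        congrArg Subtype.val e
      rw [← q.out_eq', ← r.out_eq', QuotientGroup.eq]
      rw [mem_subgroupOf]
      apply hC
      have e2 : (q.out : G) * x ^ 2 * (q.out : G)⁻¹ * (r.out : G) = (r.out : G) * x ^ 2 := by
        rw [ecoe]; simp
      change ((q.out : G)⁻¹ * (r.out : G)) * x ^ 2 = x ^ 2 * ((q.out : G)⁻¹ * (r.out : G))
      rw [mul_assoc, ← e2]
      simp [mul_assoc]
  have hperm := perm_solvable hcard
  have hk : Group.IsSolvable (MulAction.toPermHom H (H ⧸ PsubH)).ker := by
    rw [← normalCore_eq_ker]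
    refine solvable_of_le (normalCore_le PsubH) ?_
    refine pgroup_solvable (p := 2) ?_
    exact P.2.of_equiv (subgroupOfEquivOfLe hPH).symm
  refine Group.isSolvable_of_ker_le_range (MulAction.toPermHom H (H ⧸ PsubH)).ker.subtype
    (MulAction.toPermHom H (H ⧸ PsubH)) ?_
  rw [range_subtype]


theorem transfer_x {A : Type*} [CommGroup A] (ϕ : P →* A) (hx : x ∈ P)
    (hS : ∀ H : Subgroup G, Group.IsSolvable H → x ∈ H → H ≤ P)
    (hx4 : x ^ 4 = 1)
    (hF : ∀ g : G, g⁻¹ * x ^ 2 * g ∈ P → g⁻¹ * x ^ 2 * g = x ^ 2)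
    (hϕ : ϕ ⟨x ^ 2, pow_mem hx 2⟩ = 1) :
    MonoidHom.transfer (H := (P : Subgroup G)) ϕ x = ϕ ⟨x, hx⟩ := by
  classical
  have := Fintype.ofFinite
    (Quotient (MulAction.orbitRel (zpowers x) (G ⧸ (P : Subgroup G))))
  rw [MonoidHom.transfer_eq_prod_quotient_orbitRel_zpowers_quot]
  let q0 : Quotient (MulAction.orbitRel (zpowers x) (G ⧸ (P : Subgroup G))) :=
    Quotient.mk'' ((1 : G) : G ⧸ (P : Subgroup G))
  have hx0 : x • ((1 : G) : G ⧸ (P : Subgroup G)) = ((1 : G) : G ⧸ (P : Subgroup G)) := by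
    rw [MulAction.Quotient.smul_mk, eq_comm, QuotientGroup.eq]
    have : (1 : G)⁻¹ * x • (1 : G) = x := by simp
    rw [this]
    exact hx
  have hfix : ∀ c : G ⧸ (P : Subgroup G), x • c = c → c = ((1 : G) : G ⧸ (P : Subgroup G)) := by
    intro c hc
    obtain ⟨g, rfl⟩ := QuotientGroup.mk_surjective c
    rw [MulAction.Quotient.smul_mk, eq_comm, QuotientGroup.eq] at hc
    have h3 : g ∈ P := mem_of_conj_x P x hx hS g (by rw [mul_assoc]; exact hc)
    rw [eq_comm, QuotientGroup.eq, inv_one, one_mul]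
    exact h3
  have hq0 : q0.out = ((1 : G) : G ⧸ (P : Subgroup G)) := by
    have h1 : Quotient.mk'' q0.out = q0 := Quotient.out_eq' q0
    have h2 : (MulAction.orbitRel (zpowers x) (G ⧸ (P : Subgroup G))) q0.out
        ((1 : G) : G ⧸ (P : Subgroup G)) := Quotient.exact' h1
    rw [MulAction.orbitRel_apply] at h2
    obtain ⟨⟨w, hw⟩, e⟩ := h2
    have hst : w ∈ MulAction.stabilizer G ((1 : G) : G ⧸ (P : Subgroup G)) := by
      have : zpowers x ≤ MulAction.stabilizer G ((1 : G) : G ⧸ (P : Subgroup G)) := by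
        rw [zpowers_le]; exact hx0
      exact this hw
    rw [← e]
    exact hst
  rw [Finset.prod_eq_single q0]
  · have hg : q0.out.out ∈ P := by
      have h1 : ((q0.out.out : G) : G ⧸ (P : Subgroup G)) = ((1 : G) : G ⧸ (P : Subgroup G)) := by
        rw [QuotientGroup.out_eq', hq0]
      rw [eq_comm, QuotientGroup.eq, inv_one, one_mul] at h1
      exact h1
    have hmp : Function.minimalPeriod (fun c : G ⧸ (P : Subgroup G) => x • c) q0.out = 1 := by
      rw [Function.minimalPeriod_eq_one_iff_isFixedPt, hq0]
      exact hx0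
    have e : (⟨q0.out.out⁻¹ * x ^ Function.minimalPeriod (x • ·) q0.out * q0.out.out,
        QuotientGroup.out_conj_pow_minimalPeriod_mem (P : Subgroup G) x q0.out⟩ : P) =
        (⟨q0.out.out, hg⟩ : P)⁻¹ * ⟨x, hx⟩ * ⟨q0.out.out, hg⟩ := by
      apply Subtype.ext
      change q0.out.out⁻¹ * x ^ Function.minimalPeriod (fun c : G ⧸ (P : Subgroup G) => x • c) q0.out
        * q0.out.out = q0.out.out⁻¹ * x * q0.out.out
      rw [hmp, pow_one]
    rw [e, map_mul, map_mul, map_inv, mul_comm, ← mul_assoc, mul_inv_cancel, one_mul]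
  · intro q _ hq
    have hm1 : Function.minimalPeriod (fun c : G ⧸ (P : Subgroup G) => x • c) q.out ≠ 1 := by
      rw [Ne, Function.minimalPeriod_eq_one_iff_isFixedPt]
      intro h
      apply hq
      have h1 := hfix _ h
      rw [← Quotient.out_eq' q, h1]
    have hm4 : Function.minimalPeriod (fun c : G ⧸ (P : Subgroup G) => x • c) q.out ∣ 2 ^ 2 := by
      apply Function.IsPeriodicPt.minimalPeriod_dvd
      change (fun c : G ⧸ (P : Subgroup G) => x • c)^[2 ^ 2] q.out = q.out
      rw [smul_iterate]
      norm_num [hx4]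
    obtain ⟨k, hk, hk2⟩ := (Nat.dvd_prime_pow Nat.prime_two).1 hm4
    have hmem := QuotientGroup.out_conj_pow_minimalPeriod_mem (P : Subgroup G) x q.out
    interval_cases k
    · exact absurd hk2 hm1
    · rw [← hϕ]
      congr 1
      apply Subtype.ext
      rw [hk2, pow_one] at hmem
      change q.out.out⁻¹ * x ^ Function.minimalPeriod (fun c : G ⧸ (P : Subgroup G) => x • c) q.out
        * q.out.out = x ^ 2
      rw [hk2, pow_one]
      exact hF _ hmem
    · rw [← map_one ϕ]
      congr 1
      apply Subtype.ext
      change q.out.out⁻¹ * x ^ Function.minimalPeriod (fun c : G ⧸ (P : Subgroup G) => x • c) q.out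
        * q.out.out = 1
      rw [hk2]
      norm_num [hx4]
  · intro h; exact absurd (Finset.mem_univ _) h

theorem solvable_of_nonabelian (h8 : Nat.card P = 8) (hx : x ∈ P)
    (hS : ∀ H : Subgroup G, Group.IsSolvable H → x ∈ H → H ≤ P)
    (hz : x * x ≠ 1) (hnc : ¬ ∀ a b : P, a * b = b * a) : Group.IsSolvable G := by
  let X : P := ⟨x, hx⟩
  obtain ⟨hX4, hXc, ⟨p, hp⟩, hcomm⟩ := struct8 h8 hnc X (fun h => hz (congrArg Subtype.val h))
  have hx4 : x ^ 4 = 1 := congrArg Subtype.val hX4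
  have hcen : ∀ p ∈ P, p * x ^ 2 = x ^ 2 * p := fun p hp => congrArg Subtype.val (hXc ⟨p, hp⟩)
  rw [← pow_two] at hz
  have hC := centralizer_le P x h8 hx hS hz hx4 hcen
  have hF := no_fusion P x h8 hx hS hz hcen hC
  let ϕ : P →* Abelianization P := Abelianization.of
  have hϕz : ϕ (X ^ 2) = 1 := by
    have h1 : ϕ X = (ϕ X)⁻¹ := by
      rw [← map_inv, ← hp, map_mul, map_mul, map_inv, mul_comm (ϕ p), mul_inv_cancel_right]
    rw [map_pow, pow_two]
    nth_rewrite 2 [h1]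
    exact mul_inv_cancel _
  have hV := transfer_x P x ϕ hx hS hx4 hF hϕz
  have hϕx : ϕ X ≠ 1 := by
    intro h
    have h1 : X ∈ commutator P := by
      rw [← Abelianization.ker_of]; exact h
    obtain ⟨k, hk⟩ := hcomm h1
    apply hz
    have hkcoe : (X ^ 2) ^ k = X := hk
    have : X ^ 2 = 1 := by
      rw [← hkcoe, ← zpow_natCast, ← zpow_mul, mul_comm, zpow_mul, zpow_natCast, ← pow_mul, hX4,
        one_zpow]
    exact congrArg Subtype.val this
  let τ : G →* Abelianization P := MonoidHom.transfer (H := (P : Subgroup G)) ϕ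
  let N : Subgroup G := τ.ker
  have hxN : x ∉ N := fun h => hϕx (hV.symm.trans h)
  have hzN : x ^ 2 ∈ N := by
    change τ (x ^ 2) = 1
    rw [map_pow]
    change (MonoidHom.transfer (H := (P : Subgroup G)) ϕ x) ^ 2 = 1
    rw [hV, ← map_pow]
    exact hϕz
  -- Sylow subgroup of the kernel
  have hinj : Function.Injective (N.subtype.subgroupComap (P : Subgroup G)) := fun a b h =>
    Subtype.ext (Subtype.ext (congrArg (fun p : P => (p : G)) h))
  have hTp : IsPGroup 2 ((P : Subgroup G).subgroupOf N) :=
    P.2.of_injective ((N.subtype.subgroupComap (P : Subgroup G)))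
      hinj
  have hTi : ¬ 2 ∣ ((P : Subgroup G).subgroupOf N).index := by
    intro h
    have h1 : (P : Subgroup G).relIndex N ∣ (P : Subgroup G).index := by
      have a1 := relIndex_mul_index (inf_le_right : (P : Subgroup G) ⊓ N ≤ N)
      have a2 := relIndex_mul_index (inf_le_left : (P : Subgroup G) ⊓ N ≤ P)
      have a3 := relIndex_mul_index (le_sup_right : N ≤ (P : Subgroup G) ⊔ N)
      rw [inf_relIndex_right] at a1
      rw [inf_relIndex_left] at a2
      rw [relIndex_sup_right] at a3
      have a4 : N.relIndex P * (P : Subgroup G).index =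
          N.relIndex P * ((P : Subgroup G).relIndex N * ((P : Subgroup G) ⊔ N).index) := by
        rw [a2, ← a1, ← a3]; ring
      have a5 : N.relIndex P ≠ 0 := Subgroup.index_ne_zero_of_finite
      exact ⟨_, Nat.eq_of_mul_eq_mul_left (Nat.pos_of_ne_zero a5) a4⟩
    exact P.not_dvd_index (h.trans h1)
  let T : Sylow 2 N := hTp.toSylow hTi
  have hTmem : ∀ n : N, n ∈ T ↔ (n : G) ∈ P := fun n => Iff.rfl
  have hTc : ∀ a b : T, a * b = b * a := by
    have hd : Nat.card T ∣ 2 ^ 3 := by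
      have h1 : Nat.card T ∣ Nat.card P :=
        card_dvd_of_injective (N.subtype.subgroupComap (P : Subgroup G))
          hinj
      rw [h8] at h1; exact h1
    have hn8 : Nat.card T ≠ 8 := by
      intro h
      have hb : Function.Bijective (N.subtype.subgroupComap (P : Subgroup G)) := by
        rw [Nat.bijective_iff_injective_and_card]
        exact ⟨hinj, h.trans h8.symm⟩
      obtain ⟨⟨n, hn⟩, e⟩ := hb.2 X
      apply hxN
      have : (n : G) = x := congrArg Subtype.val e
      rw [← this]; exact n.2
    obtain ⟨k, hk, hk2⟩ := (Nat.dvd_prime_pow Nat.prime_two).1 hd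
    interval_cases k
    · have := (isCyclic_of_card_dvd_prime (α := T) (p := 2) (by rw [hk2]; norm_num))
      exact (IsCyclic.isMulCommutative (α := T)).is_comm.comm
    · have := (isCyclic_of_card_dvd_prime (α := T) (p := 2) (by rw [hk2]; norm_num))
      exact (IsCyclic.isMulCommutative (α := T)).is_comm.comm
    · exact (IsPGroup.isMulCommutative_of_card_eq_prime_sq hk2).is_comm.comm
    · exact absurd hk2 hn8
  have hNT : normalizer (T : Set N) ≤ centralizer (T : Set N) := by
    intro y hy t ht
    have h1 : y⁻¹ * ⟨x ^ 2, hzN⟩ * y ∈ T := by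
      have := (inv_mem hy) ⟨x ^ 2, hzN⟩
      rw [inv_inv] at this
      exact this.1 (pow_mem hx 2)
    have h2 := hF (y : G) h1
    have hyP : (y : G) ∈ P := by
      apply hC
      rw [mul_assoc, inv_mul_eq_iff_eq_mul] at h2
      exact h2.symm
    exact congrArg Subtype.val (hTc ⟨t, ht⟩ ⟨y, hyP⟩)
  let κ : N →* T := MonoidHom.transferSylow T hNT
  have hκ : ¬ 2 ∣ Nat.card κ.ker := MonoidHom.not_dvd_card_ker_transferSylow T hNT
  have hodd : ∀ n : N, n ∈ κ.ker ↔ ¬ 2 ∣ orderOf n := by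
    intro n
    constructor
    · intro h h2
      apply hκ
      have := orderOf_dvd_natCard (⟨n, h⟩ : κ.ker)
      rw [Subgroup.orderOf_mk] at this
      exact h2.trans this
    · intro h
      have h1 : orderOf (κ n) ∣ orderOf n := orderOf_map_dvd κ n
      obtain ⟨k, hk⟩ := (IsPGroup.iff_orderOf.1 T.2) (κ n)
      rw [hk] at h1
      have : k = 0 := by
        by_contra hk0
        exact h ((dvd_pow_self 2 hk0).trans h1)
      rw [this, pow_zero, orderOf_eq_one_iff] at hk
      exact hk
  let K : Subgroup G := κ.ker.map N.subtype
  have hKn : K.Normal := by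
    constructor
    rintro _ ⟨n, hn, rfl⟩ g
    refine ⟨⟨g * n * g⁻¹, (inferInstance : N.Normal).conj_mem n n.2 g⟩, ?_, rfl⟩
    refine (hodd _).2 ?_
    have h1 := (hodd n).1 hn
    rw [← Subgroup.orderOf_coe] at h1 ⊢
    have : orderOf (g * (n : G) * g⁻¹) = orderOf (n : G) :=
      orderOf_injective (MulAut.conj g).toMonoidHom (MulAut.conj g).injective (n : G)
    change ¬ 2 ∣ orderOf (g * (n : G) * g⁻¹)
    rwa [this]
  have hKc : Nat.card K = Nat.card κ.ker :=
    (Nat.card_congr (equivMapOfInjective κ.ker _ N.subtype_injective).toEquiv).symm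
  refine solvable_of_complement P ?_ K (by rw [hKc]; exact hκ) ?_
  · intro H h1 h2
    rw [le_antisymm (hS H h1 (h2 hx)) h2]
    change Nat.card P < _
    omega
  · -- the quotient is a `2`-group
    intro q
    obtain ⟨g, rfl⟩ := QuotientGroup.mk_surjective q
    have hA : IsPGroup 2 (Abelianization P) := P.2.of_surjective ϕ (QuotientGroup.mk'_surjective _)
    obtain ⟨k, hk⟩ := hA (τ g)
    rw [← map_pow] at hk
    obtain ⟨l, hl⟩ := T.2 (κ ⟨g ^ 2 ^ k, hk⟩)
    rw [← map_pow] at hl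
    refine ⟨k + l, ?_⟩
    rw [← QuotientGroup.mk_pow, QuotientGroup.eq_one_iff]
    refine ⟨_, hl, ?_⟩
    change (g ^ 2 ^ k) ^ 2 ^ l = _
    rw [← pow_mul, pow_add]

end eight
end Sol8

theorem stmt12 {G : Type*} [Group G] [Finite G] (hG : ¬ IsSolvable G) (x : G) :
    Nat.card (Sol x) ≠ 8 := by
  intro h8
  apply hG
  change Group.IsSolvable G
  have hall : (∀ y, y ∈ Sol x) → Group.IsSolvable G := by
    intro h
    have e : Sol x = Set.univ := Set.eq_univ_of_forall h
    rw [e, Nat.card_univ] at h8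
    exact Sol8.pgroup_solvable (IsPGroup.of_card (p := 2) (n := 3) h8)
  have ho : orderOf x ∣ 2 ^ 3 := by
    have := Sol8.orderOf_dvd_sol x
    rw [h8] at this; exact this
  have hxp : IsPGroup 2 (zpowers x) := by
    obtain ⟨k, hk, hk2⟩ := (Nat.dvd_prime_pow Nat.prime_two).1 ho
    exact IsPGroup.of_card (n := k) (by rw [Nat.card_zpowers, hk2])
  obtain ⟨P, hP⟩ := hxp.exists_le_sylow
  have hx : x ∈ P := hP (mem_zpowers x)
  have hle : ∀ H : Subgroup G, Group.IsSolvable H → x ∈ H → Nat.card H ≤ 8 :=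
    fun H h1 h2 => Sol8.sol_card_le h8 h1 h2
  obtain ⟨n, hn⟩ := P.2.exists_card_eq
  have hPs : Group.IsSolvable P := Sol8.pgroup_solvable P.2
  have hP8 : Nat.card P ≤ 8 := hle P hPs hx
  by_cases hx1 : x = 1
  · refine hall fun y => Sol8.sol_of_le (Sol8.zpowers_solvable y) ?_ (mem_zpowers y)
    rw [hx1]; exact one_mem _
  have hn3 : n ≤ 3 := by
    by_contra h
    have : 2 ^ 4 ≤ 2 ^ n := Nat.pow_le_pow_right (by norm_num) (by omega)
    omega
  have habel : (∀ H : Subgroup G, Group.IsSolvable H → (P : Subgroup G) ≤ H → H ≤ P) →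
      (∀ a b : P, a * b = b * a) → Group.IsSolvable G := fun h1 h2 =>
    Sol8.solvable_of_abelian P h1 fun a ha b hb => congrArg Subtype.val (h2 ⟨a, ha⟩ ⟨b, hb⟩)
  interval_cases n
  · exfalso
    have : (P : Subgroup G) = ⊥ := card_eq_one.1 hn
    have h2 : x ∈ (P : Subgroup G) := hx
    rw [this, mem_bot] at h2
    exact hx1 h2
  · -- order two
    refine Sol8.solvable_of_burnside P (fun H h1 h2 => ?_) ?_
    · have := hle H h1 (h2 hx)
      rw [hn]; omega
    · have hcyc : IsCyclic P := isCyclic_of_prime_card (p := 2) hn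
      have h2 : 2 ∣ Nat.card G := by
        have := card_subgroup_dvd_card (P : Subgroup G)
        rw [hn] at this; exact this
      exact IsCyclic.normalizer_le_centralizer ((Nat.minFac_eq_two_iff _).2 h2) hcyc
  · refine habel (fun H h1 h2 => ?_) (IsPGroup.isMulCommutative_of_card_eq_prime_sq hn).is_comm.comm
    have h3 := hle H h1 (h2 hx)
    have h4 : Nat.card P ∣ Nat.card H := card_dvd_of_le h2
    have h5 : ¬ 2 ∣ (P : Subgroup G).relIndex H := fun h =>
      P.not_dvd_index (h.trans (relIndex_dvd_index_of_le h2))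
    have h6 : (P : Subgroup G).relIndex H * Nat.card P = Nat.card H := by
      have := ((P : Subgroup G).subgroupOf H).index_mul_card
      rwa [show Nat.card ((P : Subgroup G).subgroupOf H) = Nat.card P from
        Nat.card_congr (subgroupOfEquivOfLe h2).toEquiv] at this
    rw [← relIndex_eq_one]
    rw [hn] at h6
    have : 0 < Nat.card H := Nat.card_pos
    omega
  · have hPS : ((P : Subgroup G) : Set G) = Sol x := by
      refine Set.eq_of_subset_of_ncard_le (fun y hy => Sol8.sol_of_le hPs hx hy) ?_ (Set.toFinite _)
      change Nat.card (Sol x) ≤ Nat.card P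
      rw [h8, hn]; norm_num
    have hS : ∀ H : Subgroup G, Group.IsSolvable H → x ∈ H → H ≤ P := by
      intro H h1 h2 y hy
      have : y ∈ Sol x := Sol8.sol_of_le h1 h2 hy
      rw [← hPS] at this
      exact this
    by_cases hc : ∀ a b : P, a * b = b * a
    · exact habel (fun H h1 h2 => hS H h1 (h2 hx)) hc
    by_cases hxx : x * x = 1
    · refine hall fun y => ?_
      have hnc : normalClosure {x} ≤ P := by
        rw [normalClosure, closure_le]
        intro t ht
        rw [Group.mem_conjugatesOfSet_iff] at ht
        obtain ⟨a, rfl, h⟩ := ht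
        obtain ⟨c, rfl⟩ := isConj_iff.1 h
        rw [hPS]
        apply Sol8.sol_of_invol hxx
        calc c * a * c⁻¹ * (c * a * c⁻¹) = c * (a * a) * c⁻¹ := by group
          _ = 1 := by rw [hxx]; simp
      refine Sol8.sol_of_normalizer (H := normalClosure {x}) (Sol8.solvable_of_le hnc hPs)
        (subset_normalClosure rfl) ?_
      rw [normalizer_eq_top]
      trivial
    · exact Sol8.solvable_of_nonabelian P x hn hx hS hxx hc
end
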